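/- arXiv:2311.13872 — 3 statements merged into one kernel-verified Lean document; each statement's English description precedes it below -/
import Mathlib

section
/- Assume additionally (A3): dom(f) = S⁺_d and there exists k > 0 with f(A) ≤ k·tr(A) for all A ∈ S⁺_d. Then for each p ∈ P(X), G([p], p) ≤ k·var(p), where [p] is the barycenter of p and var(p) = ∫_X |y|² dp(y) − |[p]|². Moreover, if f = tr on S⁺_d, then G([p], p) = var(p) for each p ∈ P(X). -/
open MeasureTheory Set Filter Topology
open scoped ENNReal NNReal Classical

noncomputable section

/-- Euclidean space `ℝ^d`. -/
abbrev Ed (d : ℕ) := EuclideanSpace ℝ (Fin d)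

/-- The space `M_d` of real `d × d` matrices. -/
abbrev Matd (d : ℕ) := Matrix (Fin d) (Fin d) ℝ

/-- The Frobenius inner product `A : B = tr(Aᵀ B)`. -/
def frob {d : ℕ} (A B : Matd d) : ℝ := ∑ i, ∑ j, A i j * B i j

/-- The Frobenius norm of a matrix. -/
def matnorm {d : ℕ} (A : Matd d) : ℝ := Real.sqrt (frob A A)

/-- The Hessian matrix `∇²φ(x)`. -/
def hess {d : ℕ} (φ : Ed d → ℝ) (x : Ed d) : Matd d :=
  fun i j => iteratedFDeriv ℝ 2 φ x ![EuclideanSpace.single i 1, EuclideanSpace.single j 1]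

/-- `φ ∈ C²_c(ℝ^d)`. -/
def IsC2c {d : ℕ} (φ : Ed d → ℝ) : Prop := ContDiff ℝ 2 φ ∧ HasCompactSupport φ

/-- Assumption (A1): `dom f ⊆ S⁺_d`, `f` is coercive and sublinear
(subadditive and positively 1-homogeneous). -/
def CostA1 {d : ℕ} (f : Matd d → ℝ≥0∞) : Prop :=
  (∀ M, f M ≠ ⊤ → M.PosSemidef) ∧
  (∃ c : ℝ, 0 < c ∧ ∀ M, ENNReal.ofReal (c * matnorm M) ≤ f M) ∧
  (∀ A B, f (A + B) ≤ f A + f B) ∧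
  (∀ t : ℝ, 0 ≤ t → ∀ A, f (t • A) = ENNReal.ofReal t * f A)

/-- Assumption (A2): `f` is lower semicontinuous. -/
def CostA2 {d : ℕ} (f : Matd d → ℝ≥0∞) : Prop := LowerSemicontinuous f

/-- `dom(f⋆) = {A | A : M ≤ f(M) for all M ∈ dom f}`. -/
def domFstar {d : ℕ} (f : Matd d → ℝ≥0∞) : Set (Matd d) :=
  { A | ∀ M, f M ≠ ⊤ → ENNReal.ofReal (frob A M) ≤ f M }

/-- A competitor `λ = ρ·m` (an `S⁺_d`-valued measure supported in `X`) for the static problem: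
`tr(½∇²λ) = ν − μ` in the distributional sense. -/
def IsStaticCompetitor {d : ℕ} (X : Set (Ed d)) (μ ν : Measure (Ed d))
    (m : Measure (Ed d)) (ρ : Ed d → Matd d) : Prop :=
  IsFiniteMeasure m ∧ m Xᶜ = 0 ∧ (∀ x, (ρ x).PosSemidef) ∧
    ∀ φ : Ed d → ℝ, IsC2c φ →
      ∫ x, (1/2 : ℝ) * frob (hess φ x) (ρ x) ∂m = ∫ x, φ x ∂ν - ∫ x, φ x ∂μ

/-- The static value `F(μ,ν)` (using the positive 1-homogeneity of `f`, the cost of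
`λ = ρ·m` is `∫ f(dλ/d|λ|) d|λ| = ∫ f(ρ) dm`). -/
def Fstat {d : ℕ} (f : Matd d → ℝ≥0∞) (X : Set (Ed d)) (μ ν : Measure (Ed d)) : ℝ≥0∞ :=
  sInf { c | ∃ m ρ, IsStaticCompetitor X μ ν m ρ ∧ c = ∫⁻ x, f (ρ x) ∂m }

/-- `(ϱ, λ)`, with `ϱ = ϱ_t ⊗ L¹⌞(0,1)` and `λ = (ρ_t · m_t) ⊗ L¹⌞(0,1)` an `S⁺_d`-valued
measure, solves the Fokker–Planck equation `∂_t ϱ = tr(½∇²λ)` on `(0,1) × ℝ^d`. -/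
def SolvesFPE {d : ℕ} (ϱ : ℝ → Measure (Ed d)) (m : ℝ → Measure (Ed d))
    (ρ : ℝ → Ed d → Matd d) : Prop :=
  (∀ t ∈ Ioo (0:ℝ) 1, IsFiniteMeasure (ϱ t) ∧ IsFiniteMeasure (m t)) ∧
  (∀ t ∈ Ioo (0:ℝ) 1, ∀ x, (ρ t x).PosSemidef) ∧
  (∀ A : Set (Ed d), IsCompact A →
    (∫⁻ t in Ioo (0:ℝ) 1, ∫⁻ x in A, ENNReal.ofReal (matnorm (ρ t x)) ∂(m t)) < ⊤) ∧
  (∀ φ : ℝ × Ed d → ℝ, ContDiff ℝ 2 φ → HasCompactSupport φ →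
    tsupport φ ⊆ Ioo (0:ℝ) 1 ×ˢ (univ : Set (Ed d)) →
    (∫ t in Ioo (0:ℝ) 1, ∫ x, fderiv ℝ φ (t, x) (1, 0) ∂(ϱ t)) =
      - ∫ t in Ioo (0:ℝ) 1, ∫ x, (1/2 : ℝ) * frob (hess (fun y => φ (t, y)) x) (ρ t x) ∂(m t))

/-- The support condition (⋆): `supp ϱ_t, supp λ_t ⊆ X` for a.e. `t ∈ (0,1)`. -/
def SuppCond {d : ℕ} (X : Set (Ed d)) (ϱ m : ℝ → Measure (Ed d)) : Prop :=
  ∀ᵐ t ∂(volume.restrict (Ioo (0:ℝ) 1)), (ϱ t) Xᶜ = 0 ∧ (m t) Xᶜ = 0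

/-- `μ` is the weak* (narrow) limit of `ϱ_t` as `t → t₀` within `(0,1)`. -/
def NarrowLim {d : ℕ} (ϱ : ℝ → Measure (Ed d)) (t₀ : ℝ) (μ : Measure (Ed d)) : Prop :=
  ∀ g : BoundedContinuousFunction (Ed d) ℝ,
    Tendsto (fun t => ∫ x, g x ∂(ϱ t)) (𝓝[Ioo (0:ℝ) 1] t₀) (𝓝 (∫ x, g x ∂μ))

/-- The dynamic (Benamou–Brenier type) value `F(μ,ν)`. -/
def Fdyn {d : ℕ} (f : Matd d → ℝ≥0∞) (X : Set (Ed d)) (μ ν : Measure (Ed d)) : ℝ≥0∞ :=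
  sInf { c | ∃ ϱ m ρ, SolvesFPE ϱ m ρ ∧ SuppCond X ϱ m ∧
      NarrowLim ϱ 0 μ ∧ NarrowLim ϱ 1 ν ∧
      c = ∫⁻ t in Ioo (0:ℝ) 1, ∫⁻ x, f (ρ t x) ∂(m t) }

/-- the cost `G(x,p) := F(δ_x, p)`. -/
def Gcost {d : ℕ} (f : Matd d → ℝ≥0∞) (X : Set (Ed d)) (x : Ed d)
    (p : Measure (Ed d)) : ℝ≥0∞ :=
  Fstat f X (Measure.dirac x) p

/-- A disintegration kernel `x ↦ γ^x` of a transport plan `γ ∈ Π(μ,ν)`. -/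
def IsTransportKernel {d : ℕ} (X : Set (Ed d)) (μ ν : Measure (Ed d))
    (κ : Ed d → Measure (Ed d)) : Prop :=
  (∀ x, IsProbabilityMeasure (κ x) ∧ (κ x) Xᶜ = 0) ∧
  (∀ A : Set (Ed d), MeasurableSet A → Measurable fun x => κ x A) ∧
  (∀ A : Set (Ed d), MeasurableSet A → ∫⁻ x, κ x A ∂μ = ν A)

/-- The static optimal transport value `H(μ,ν) = inf_{γ ∈ Π(μ,ν)} ∫ G(x,γ^x) dμ`. -/
def Hcost {d : ℕ} (f : Matd d → ℝ≥0∞) (X : Set (Ed d)) (μ ν : Measure (Ed d)) : ℝ≥0∞ :=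
  sInf { c | ∃ κ, IsTransportKernel X μ ν κ ∧ c = ∫⁻ x, Gcost f X x (κ x) ∂μ }

/-- Integral of `φ` against a signed measure. -/
def sInt {d : ℕ} (s : SignedMeasure (Ed d)) (φ : Ed d → ℝ) : ℝ :=
  ∫ x, φ x ∂s.toJordanDecomposition.posPart - ∫ x, φ x ∂s.toJordanDecomposition.negPart

/-- A signed measure is supported in `X`. -/
def SuppInX {d : ℕ} (X : Set (Ed d)) (s : SignedMeasure (Ed d)) : Prop :=
  ∀ A : Set (Ed d), MeasurableSet A → A ⊆ Xᶜ → s A = 0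

/-- The extension of `F` to signed measures: `+∞` unless `μ, ν ≥ 0` with equal masses. -/
def FSgn {d : ℕ} (f : Matd d → ℝ≥0∞) (X : Set (Ed d)) (μ ν : SignedMeasure (Ed d)) : ℝ≥0∞ :=
  if 0 ≤ μ ∧ 0 ≤ ν ∧ μ univ = ν univ then
    Fstat f X μ.toJordanDecomposition.posPart ν.toJordanDecomposition.posPart
  else ⊤

/-- The extension of `H` to signed measures: `+∞` unless `μ, ν ≥ 0` with equal masses. -/
def HSgn {d : ℕ} (f : Matd d → ℝ≥0∞) (X : Set (Ed d)) (μ ν : SignedMeasure (Ed d)) : ℝ≥0∞ :=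
  if 0 ≤ μ ∧ 0 ≤ ν ∧ μ univ = ν univ then
    Hcost f X μ.toJordanDecomposition.posPart ν.toJordanDecomposition.posPart
  else ⊤

/-- The weak* topology on signed measures, in duality with continuous functions. -/
def weakStarTop (d : ℕ) : TopologicalSpace (SignedMeasure (Ed d)) :=
  ⨅ g : C(Ed d, ℝ), TopologicalSpace.induced (fun s => sInt s g) inferInstance

/-- The `G`-transform `φ^G(x) = inf { ∫ φ dp + G(x,p) : p ∈ P(X) }`. -/
def GTrans {d : ℕ} (f : Matd d → ℝ≥0∞) (X : Set (Ed d)) (φ : Ed d → ℝ) (x : Ed d) : EReal :=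
  sInf { c : EReal | ∃ p : Measure (Ed d), IsProbabilityMeasure p ∧ p Xᶜ = 0 ∧
      c = ((∫ y, φ y ∂p : ℝ) : EReal) + (Gcost f X x p : EReal) }

/-- `φ = φ^G` on `E`. -/
def GEq {d : ℕ} (f : Matd d → ℝ≥0∞) (X : Set (Ed d)) (φ : Ed d → ℝ) (E : Set (Ed d)) : Prop :=
  ∀ x ∈ E, GTrans f X φ x = ((φ x : ℝ) : EReal)

/-- `𝒯(A) = sup { A : M | M ∈ S⁺⁺_d, f(M) = 1 }`. -/
def Tcal {d : ℕ} (f : Matd d → ℝ≥0∞) (A : Matd d) : EReal :=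
  sSup { c : EReal | ∃ M : Matd d, M.PosDef ∧ f M = 1 ∧ c = ((frob A M : ℝ) : EReal) }

/-- `u` is a viscosity supersolution of `c − 𝒯(½∇²u) = 0` in `U`. -/
def IsViscSupersol {d : ℕ} (f : Matd d → ℝ≥0∞) (c : ℝ) (u : Ed d → ℝ) (U : Set (Ed d)) : Prop :=
  ∀ φ : Ed d → ℝ, ContDiffOn ℝ 2 φ U → ∀ x ∈ U,
    IsLocalMinOn (fun y => u y - φ y) U x →
    Tcal f ((1/2 : ℝ) • hess φ x) ≤ ((c : ℝ) : EReal)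

/-- Integral of an `EReal`-valued function against a measure
(positive part minus negative part). -/
def erealInt {d : ℕ} (m : Measure (Ed d)) (u : Ed d → EReal) : EReal :=
  ((∫⁻ y, ENNReal.ofReal ((u y).toReal) ∂m : ℝ≥0∞) : EReal) -
    ((∫⁻ y, (if u y = ⊥ then (⊤ : ℝ≥0∞) else ENNReal.ofReal (-(u y).toReal)) ∂m : ℝ≥0∞) : EReal)

/-- `u : U → ℝ ∪ {−∞}` is subharmonic on the open set `U`: it is upper semicontinuous,
not identically `−∞` on any connected component, and satisfies the sub-mean value
inequality on spheres. -/
def Subharmonic {d : ℕ} (U : Set (Ed d)) (u : Ed d → EReal) : Prop :=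
  (∀ x, u x ≠ ⊤) ∧
  (∀ x ∈ U, ∃ y ∈ connectedComponentIn U x, u y ≠ ⊥) ∧
  UpperSemicontinuousOn u U ∧
  (∀ x ∈ U, ∀ r : ℝ, 0 < r → Metric.closedBall x r ⊆ U →
    (((μH[(d : ℝ) - 1] (Metric.sphere x r)).toReal : ℝ) : EReal) * u x ≤
      erealInt ((μH[(d : ℝ) - 1]).restrict (Metric.sphere x r)) u)

/-- The (topological) support of a measure. -/
def msupp {d : ℕ} (m : Measure (Ed d)) : Set (Ed d) :=
  { x | ∀ U : Set (Ed d), IsOpen U → x ∈ U → m U ≠ 0 }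

/-- `m₁ ≤_SH m₂`: subharmonic order. -/
def SHOrder {d : ℕ} (m₁ m₂ : Measure (Ed d)) : Prop :=
  ∀ U : Set (Ed d), IsOpen U → msupp (m₁ + m₂) ⊆ U →
    ∀ u : Ed d → EReal, Subharmonic U u →
      erealInt (m₁.restrict U) u ≤ erealInt (m₂.restrict U) u

/-- The second moment matrix `∫ x ⊗ x dκ`. -/
def secondMoment {d : ℕ} (κ : Measure (Ed d)) : Matd d :=
  fun i j => ∫ x, x i * x j ∂κ

end

section Helpers

variable {d : ℕ}

lemma frob_hess_vec (φ : Ed d → ℝ) (z v : Ed d) (c : ℝ) :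
    frob (hess φ z) (fun i j => v i * v j / c) = fderiv ℝ (fderiv ℝ φ) z v v / c := by
  have hv : v = ∑ i, v i • EuclideanSpace.single i (1:ℝ) := by
    ext j
    simp [Finset.sum_apply, Pi.single_apply]
  have h2 : fderiv ℝ (fderiv ℝ φ) z v v =
      ∑ i, ∑ j, v i * (v j * fderiv ℝ (fderiv ℝ φ) z (EuclideanSpace.single i (1:ℝ))
        (EuclideanSpace.single j (1:ℝ))) := by
    conv_lhs => rw [hv]
    simp only [map_sum, map_smul, _root_.sum_apply, _root_.smul_apply,
      smul_eq_mul, Finset.mul_sum]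
    rw [Finset.sum_comm]
    refine Finset.sum_congr rfl fun i _ => Finset.sum_congr rfl fun j _ => ?_
    ring
  rw [h2]
  unfold frob hess
  simp only [Finset.sum_div]
  refine Finset.sum_congr rfl fun i _ => Finset.sum_congr rfl fun j _ => ?_
  rw [iteratedFDeriv_two_apply]
  simp
  ring

lemma taylor_int (φ : Ed d → ℝ) (hφ : ContDiff ℝ 2 φ) (x v : Ed d) :
    ∫ t in (0:ℝ)..1, (1 - t) * fderiv ℝ (fderiv ℝ φ) (x + t • v) v v =
      φ (x + v) - φ x - fderiv ℝ φ x v := by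
  have hφ1 : ContDiff ℝ 1 (fderiv ℝ φ) := hφ.fderiv_right (by norm_num)
  have hl : ∀ t : ℝ, HasDerivAt (fun t : ℝ => x + t • v) v t := by
    intro t
    simpa using ((hasDerivAt_id t).smul_const v).const_add x
  have h0 : ∀ t : ℝ, HasDerivAt (fun t : ℝ => φ (x + t • v)) (fderiv ℝ φ (x + t • v) v) t := by
    intro t
    exact ((hφ.differentiable (by norm_num)) _).hasFDerivAt.comp_hasDerivAt t (hl t)
  have h1 : ∀ t : ℝ, HasDerivAt (fun t : ℝ => fderiv ℝ φ (x + t • v) v)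
      (fderiv ℝ (fderiv ℝ φ) (x + t • v) v v) t := by
    intro t
    have := ((hφ1.differentiable (by norm_num)) (x + t • v)).hasFDerivAt.comp_hasDerivAt t (hl t)
    have h3 := this.clm_apply (hasDerivAt_const t v)
    simpa using h3
  have h2 : ∀ t : ℝ, HasDerivAt (fun t : ℝ => (1 - t) * fderiv ℝ φ (x + t • v) v + φ (x + t • v))
      ((1 - t) * fderiv ℝ (fderiv ℝ φ) (x + t • v) v v) t := by
    intro t
    have := (((hasDerivAt_id t).const_sub 1).mul (h1 t)).add (h0 t)
    refine this.congr_deriv ?_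
    simp
  have hc : Continuous (fderiv ℝ (fderiv ℝ φ)) := hφ1.continuous_fderiv (by norm_num)
  rw [intervalIntegral.integral_eq_sub_of_hasDerivAt (fun t _ => h2 t)]
  · simp; ring
  · apply Continuous.intervalIntegrable
    fun_prop

lemma rho_psd (v : Ed d) (c : ℝ) (hc : 0 ≤ c) :
    Matrix.PosSemidef (fun i j => v i * v j / c : Matd d) := by
  have h := (Matrix.posSemidef_vecMulVec_self_star (R := ℝ) (fun i => v i)).smul (inv_nonneg.2 hc)
  have e : (fun i j => v i * v j / c : Matd d) =
      c⁻¹ • Matrix.vecMulVec (fun i => v i) (star fun i => v i) := by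
    ext i j
    simp [Matrix.vecMulVec, div_eq_inv_mul]
  rw [e]
  exact h

lemma rho_trace (v : Ed d) :
    Matrix.trace (fun i j => v i * v j / ‖v‖ ^ 2 : Matd d) ≤ 1 := by
  have : Matrix.trace (fun i j => v i * v j / ‖v‖ ^ 2 : Matd d) = ‖v‖ ^ 2 / ‖v‖ ^ 2 := by
    simp only [Matrix.trace, Matrix.diag]
    rw [← Finset.sum_div, EuclideanSpace.norm_sq_eq]
    simp [sq]
  rw [this]
  exact div_self_le_one _

lemma cont_integrable {α : Type*} [TopologicalSpace α] [MeasurableSpace α] [OpensMeasurableSpace α]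
    [SecondCountableTopology α]
    (Q : Measure α) [IsFiniteMeasure Q] (K : Set α) (hK : IsCompact K) (hQ : ∀ᵐ z ∂Q, z ∈ K)
    {E : Type*} [NormedAddCommGroup E] [SecondCountableTopology E]
    (g : α → E) (hg : Continuous g) : Integrable g Q := by
  obtain ⟨C, hC⟩ := hK.exists_bound_of_continuousOn hg.continuousOn
  borelize E
  exact Integrable.of_bound hg.measurable.aestronglyMeasurable C (hQ.mono fun z hz => hC z hz)

lemma var_eq (X : Set (Ed d)) (hX : IsCompact X) (p : Measure (Ed d)) [IsProbabilityMeasure p]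
    (hp : ∀ᵐ y ∂p, y ∈ X) :
    ∫ y, ‖y - ∫ z, z ∂p‖ ^ 2 ∂p = (∫ y, ‖y‖ ^ 2 ∂p) - ‖∫ y, y ∂p‖ ^ 2 := by
  set x := ∫ z, z ∂p with hx
  have hi : Integrable (fun y : Ed d => y) p := cont_integrable p X hX hp _ continuous_id
  have hi2 : Integrable (fun y : Ed d => ‖y‖ ^ 2) p :=
    cont_integrable p X hX hp _ (by fun_prop)
  have hi3 : Integrable (fun y : Ed d => 2 * inner ℝ x y) p :=
    cont_integrable p X hX hp _ (by fun_prop)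
  have h : ∀ y : Ed d, ‖y - x‖ ^ 2 = ‖y‖ ^ 2 - 2 * inner ℝ x y + ‖x‖ ^ 2 := by
    intro y
    rw [norm_sub_sq_real, real_inner_comm]
  simp_rw [h]
  have hi4 : Integrable (fun y : Ed d => ‖y‖ ^ 2 - 2 * inner ℝ x y) p := hi2.sub hi3
  rw [integral_add hi4 (integrable_const _), integral_sub hi2 hi3,
    integral_const_mul, integral_inner hi, ← hx, real_inner_self_eq_norm_sq]
  simp
  ring

lemma upper (f : Matd d → ℝ≥0∞) (X : Set (Ed d)) (hX : IsCompact X) (hXc : Convex ℝ X)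
    (k : ℝ) (hk : 0 < k)
    (hA3bd : ∀ A : Matd d, A.PosSemidef → f A ≤ ENNReal.ofReal (k * A.trace))
    (p : Measure (Ed d)) [IsProbabilityMeasure p] (hp0 : p Xᶜ = 0) :
    Gcost f X (∫ y, y ∂p) p ≤
        ENNReal.ofReal (k * ((∫ y, ‖y‖ ^ 2 ∂p) - ‖∫ y, y ∂p‖ ^ 2)) := by
  have hp : ∀ᵐ y ∂p, y ∈ X := hp0
  rw [← var_eq X hX p hp]
  have hi : Integrable (fun y : Ed d => y) p := cont_integrable p X hX hp _ continuous_id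
  have hxX : (∫ y, y ∂p) ∈ X := hXc.integral_mem hX.isClosed hp hi
  have hx : ∫ y, y ∂p = ∫ y, y ∂p := rfl
  generalize hxdef : (∫ y, y ∂p) = x at *
  clear hx
  set Q : Measure (ℝ × Ed d) := (volume.restrict (Ioc (0:ℝ) 1)).prod p with hQ
  have hQae : ∀ᵐ z ∂Q, z.1 ∈ Ioc (0:ℝ) 1 ∧ z.2 ∈ X := by
    have h1 : ∀ᵐ t ∂(volume.restrict (Ioc (0:ℝ) 1)), t ∈ Ioc (0:ℝ) 1 :=
      ae_restrict_mem measurableSet_Ioc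
    have a1 : ∀ᵐ z ∂Q, z.1 ∈ Ioc (0:ℝ) 1 := Measure.quasiMeasurePreserving_fst.ae h1
    have a2 : ∀ᵐ z ∂Q, z.2 ∈ X := Measure.quasiMeasurePreserving_snd.ae hp
    exact a1.and a2
  have hQint : ∀ g : ℝ × Ed d → ℝ, Continuous g → Integrable g Q := fun g hg =>
    cont_integrable Q (Icc 0 1 ×ˢ X) (isCompact_Icc.prod hX)
      (hQae.mono fun z hz => ⟨Ioc_subset_Icc_self hz.1, hz.2⟩) g hg
  let w : ℝ × Ed d → ℝ := fun z => (2 * (1 - z.1)) * ‖z.2 - x‖ ^ 2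
  have hwc : Continuous w := by fun_prop
  have hw0 : ∀ᵐ z ∂Q, 0 ≤ w z := hQae.mono fun z hz => by
    have := hz.1.2
    have : 0 ≤ 1 - z.1 := by linarith
    positivity
  have hwint : ∫ z, w z ∂Q = ∫ y, ‖y - x‖ ^ 2 ∂p := by
    have := integral_prod_mul (μ := volume.restrict (Ioc (0:ℝ) 1)) (ν := p)
      (fun t : ℝ => 2 * (1 - t)) (fun y : Ed d => ‖y - x‖ ^ 2)
    rw [this, ← intervalIntegral.integral_of_le zero_le_one]
    have h3 : ∫ t in (0:ℝ)..1, 2 * (1 - t) = 1 := by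
      rw [intervalIntegral.integral_const_mul, intervalIntegral.integral_sub (by simp) (by simp)]
      simp
      norm_num
    rw [h3, one_mul]
  let T : ℝ × Ed d → Ed d := fun z => x + z.1 • (z.2 - x)
  have hTc : Continuous T := by fun_prop
  let W : Measure (ℝ × Ed d) := Q.withDensity (fun z => ENNReal.ofReal (w z))
  let m : Measure (Ed d) := W.map T
  let ρ : Ed d → Matd d := fun z i j => (z - x) i * (z - x) j / ‖z - x‖ ^ 2
  have hmuniv : m univ = ENNReal.ofReal (∫ y, ‖y - x‖ ^ 2 ∂p) := by
    rw [Measure.map_apply hTc.measurable MeasurableSet.univ, preimage_univ,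
      withDensity_apply _ MeasurableSet.univ, Measure.restrict_univ,
      ← ofReal_integral_eq_lintegral_ofReal (hQint w hwc) hw0, hwint]
  have hWae : ∀ᵐ z ∂W, z.1 ∈ Ioc (0:ℝ) 1 ∧ z.2 ∈ X :=
    (withDensity_absolutelyContinuous _ _).ae_le hQae
  have hle : IsStaticCompetitor X (Measure.dirac x) p m ρ →
      Gcost f X x p ≤ ∫⁻ z, f (ρ z) ∂m := fun h => sInf_le ⟨m, ρ, h, rfl⟩
  refine (hle ⟨⟨?_⟩, ?_, ?_, ?_⟩).trans ?_
  · rw [hmuniv]; exact ENNReal.ofReal_lt_top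
  · rw [Measure.map_apply hTc.measurable hX.isClosed.measurableSet.compl]
    refine hWae.mono fun z hz => ?_
    have := hXc.add_smul_sub_mem hxX hz.2 (Ioc_subset_Icc_self hz.1)
    exact this
  · intro z
    exact rho_psd _ _ (by positivity)
  · intro φ hφ
    have hφ1 : ContDiff ℝ 1 (fderiv ℝ φ) := hφ.1.fderiv_right (by norm_num)
    have hc : Continuous (fderiv ℝ (fderiv ℝ φ)) := hφ1.continuous_fderiv (by norm_num)
    have e1 : ∀ z, frob (hess φ z) (ρ z) =
        fderiv ℝ (fderiv ℝ φ) z (z - x) (z - x) / ‖z - x‖ ^ 2 := fun z => frob_hess_vec φ z _ _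
    simp_rw [e1]
    have hmeas : Measurable fun z => (1 / 2 : ℝ) *
        (fderiv ℝ (fderiv ℝ φ) z (z - x) (z - x) / ‖z - x‖ ^ 2) := by
      apply Measurable.const_mul
      apply Measurable.div
      · exact Continuous.measurable (by fun_prop)
      · exact Continuous.measurable (by fun_prop)
    rw [integral_map hTc.aemeasurable hmeas.aestronglyMeasurable,
      integral_withDensity_eq_integral_toReal_smul (by fun_prop) (by simp)]
    have e2 : ∀ᵐ z ∂Q, (ENNReal.ofReal (w z)).toReal • ((1 / 2 : ℝ) *
        (fderiv ℝ (fderiv ℝ φ) (T z) (T z - x) (T z - x) / ‖T z - x‖ ^ 2)) =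
        (1 - z.1) * fderiv ℝ (fderiv ℝ φ) (x + z.1 • (z.2 - x)) (z.2 - x) (z.2 - x) := by
      filter_upwards [hw0, hQae] with z hz hz2
      rw [ENNReal.toReal_ofReal hz]
      have ht : z.1 ≠ 0 := hz2.1.1.ne'
      simp only [T, w, add_sub_cancel_left, norm_smul, map_smul, ContinuousLinearMap.smul_apply,
        smul_eq_mul, mul_pow, Real.norm_eq_abs, sq_abs]
      by_cases hv : z.2 - x = 0
      · simp [hv]
      · have : ‖z.2 - x‖ ≠ 0 := norm_ne_zero_iff.2 hv
        field_simp
    rw [integral_congr_ae e2, hQ, integral_prod_symm _ (hQint _ (by fun_prop))]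
    simp_rw [← intervalIntegral.integral_of_le (zero_le_one (α := ℝ)), taylor_int φ hφ.1]
    have hφc : Continuous φ := hφ.1.continuous
    have i1 : Integrable (fun y : Ed d => φ y) p := cont_integrable p X hX hp _ hφc
    have i2 : Integrable (fun y : Ed d => y - x) p :=
      cont_integrable p X hX hp _ (by fun_prop)
    have i3 : Integrable (fun y : Ed d => fderiv ℝ φ x (y - x)) p :=
      cont_integrable p X hX hp _ (by fun_prop)
    simp only [add_sub_cancel]
    have i4 : Integrable (fun y : Ed d => φ y - φ x) p := i1.sub (integrable_const _)
    rw [integral_sub i4 i3, integral_sub i1 (integrable_const _),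
      ContinuousLinearMap.integral_comp_comm _ i2, integral_sub hi (integrable_const _), hxdef]
    simp
  · calc ∫⁻ z, f (ρ z) ∂m ≤ ∫⁻ z, ENNReal.ofReal k ∂m := by
          refine lintegral_mono fun z => (hA3bd _ (rho_psd _ _ (by positivity))).trans ?_
          apply ENNReal.ofReal_le_ofReal
          have := rho_trace (z - x)
          exact (mul_le_mul_of_nonneg_left this hk.le).trans (mul_one k).le
      _ = _ := by
          rw [lintegral_const, hmuniv, ENNReal.ofReal_mul hk.le]

lemma lower (f : Matd d → ℝ≥0∞) (X : Set (Ed d)) (hX : IsCompact X) (hXc : Convex ℝ X)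
    (hf : ∀ A : Matd d, A.PosSemidef → f A = ENNReal.ofReal A.trace)
    (p : Measure (Ed d)) [IsProbabilityMeasure p] (hp0 : p Xᶜ = 0) :
    ENNReal.ofReal ((∫ y, ‖y‖ ^ 2 ∂p) - ‖∫ y, y ∂p‖ ^ 2) ≤ Gcost f X (∫ y, y ∂p) p := by
  have hp : ∀ᵐ y ∂p, y ∈ X := hp0
  have hi : Integrable (fun y : Ed d => y) p := cont_integrable p X hX hp _ continuous_id
  have hxX : (∫ y, y ∂p) ∈ X := hXc.integral_mem hX.isClosed hp hi
  refine le_sInf ?_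
  rintro c ⟨m, ρ, ⟨hm, hmX, hρ, hcomp⟩, rfl⟩
  obtain ⟨R, hR0, hR⟩ := hX.isBounded.subset_ball_lt 0 (0 : Ed d)
  let ψ : ContDiffBump (0 : Ed d) := ⟨R, R + 1, hR0, by linarith⟩
  let φ : Ed d → ℝ := fun y => ψ y * ‖y‖ ^ 2
  have hφ : IsC2c φ := by
    refine ⟨ψ.contDiff.mul (contDiff_norm_sq ℝ), ψ.hasCompactSupport.mul_right⟩
  have hφX : ∀ y ∈ X, φ =ᶠ[𝓝 y] fun y => ‖y‖ ^ 2 := by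
    intro y hy
    filter_upwards [Metric.isOpen_ball.mem_nhds (hR hy)] with z hz
    have : ψ z = 1 := ψ.one_of_mem_closedBall (Metric.ball_subset_closedBall hz)
    simp [φ, this]
  have hmae : ∀ᵐ y ∂m, y ∈ X := hmX
  have hh : ∀ y ∈ X, (1/2 : ℝ) * frob (hess φ y) (ρ y) = (ρ y).trace := by
    intro y hy
    have e : ∀ i j, hess φ y i j = 2 * (if i = j then 1 else 0) := by
      intro i j
      have h1 : iteratedFDeriv ℝ 2 φ y = iteratedFDeriv ℝ 2 (fun y : Ed d => ‖y‖ ^ 2) y :=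
        (Filter.EventuallyEq.iteratedFDeriv ℝ (hφX y hy) 2).eq_of_nhds
      unfold hess
      have h2 : fderiv ℝ (fderiv ℝ fun y : Ed d => ‖y‖ ^ 2) y = 2 • innerSL ℝ (E := Ed d) := by
        rw [fderiv_norm_sq]
        exact (2 • innerSL ℝ (E := Ed d)).fderiv
      rw [h1, iteratedFDeriv_two_apply, h2]
      have h3 : innerSL ℝ (EuclideanSpace.single i (1:ℝ) : Ed d) (EuclideanSpace.single j (1:ℝ)) =
          if i = j then 1 else 0 := by
        rw [innerSL_apply_apply, EuclideanSpace.inner_single_left]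
        simp [Pi.single_apply]
      rw [← h3]
      simp
      rfl
    unfold frob
    simp only [e, Matrix.trace, Matrix.diag, Finset.mul_sum]
    refine Finset.sum_congr rfl fun i _ => ?_
    simp
  have key := hcomp φ hφ
  rw [integral_congr_ae (hmae.mono fun y hy => hh y hy), integral_dirac,
    (hφX _ hxX).eq_of_nhds,
    integral_congr_ae (hp.mono fun y hy => (hφX y hy).eq_of_nhds)] at key
  rw [← key]
  simp_rw [fun x => hf _ (hρ x)]
  by_cases hint : Integrable (fun y => (ρ y).trace) m
  · exact (ofReal_integral_eq_lintegral_ofReal hint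
      (Eventually.of_forall fun y => (hρ y).trace_nonneg)).le
  · rw [integral_undef hint]
    simp

end Helpers

/-- Proposition 4.5. Under (A3), for each `p ∈ P(X)`,
`G([p], p) ≤ k·var(p)`; moreover, if `f = tr` on `S⁺_d`, then `G([p], p) = var(p)`. -/
theorem stmt14 {d : ℕ} (hd : 0 < d) (f : Matd d → ℝ≥0∞) (hA1 : CostA1 f) (hA2 : CostA2 f)
    (Ω X : Set (Ed d)) (hΩopen : IsOpen Ω) (hΩconv : Convex ℝ Ω)
    (hΩbdd : Bornology.IsBounded Ω) (hΩne : Ω.Nonempty) (hX : X = closure Ω)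
    (k : ℝ) (hk : 0 < k)
    (hA3dom : ∀ M : Matd d, f M ≠ ⊤ ↔ M.PosSemidef)
    (hA3bd : ∀ A : Matd d, A.PosSemidef → f A ≤ ENNReal.ofReal (k * A.trace)) :
    (∀ p : Measure (Ed d), IsProbabilityMeasure p → p Xᶜ = 0 →
      Gcost f X (∫ y, y ∂p) p ≤
        ENNReal.ofReal (k * ((∫ y, ‖y‖ ^ 2 ∂p) - ‖∫ y, y ∂p‖ ^ 2))) ∧
    ((∀ A : Matd d, A.PosSemidef → f A = ENNReal.ofReal A.trace) →
      ∀ p : Measure (Ed d), IsProbabilityMeasure p → p Xᶜ = 0 →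
        Gcost f X (∫ y, y ∂p) p =
          ENNReal.ofReal ((∫ y, ‖y‖ ^ 2 ∂p) - ‖∫ y, y ∂p‖ ^ 2)) := by
  have hXcpt : IsCompact X := hX ▸ hΩbdd.isCompact_closure
  have hXc : Convex ℝ X := hX ▸ hΩconv.closure
  refine ⟨fun p hp hp0 => upper f X hXcpt hXc k hk hA3bd p hp0, fun hf p hp hp0 => ?_⟩
  refine le_antisymm ?_ (lower f X hXcpt hXc hf p hp0)
  have := upper f X hXcpt hXc 1 one_pos (fun A hA => by rw [one_mul, hf A hA]) p hp0
  rwa [one_mul] at this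
end

section
/- Assume (A3): dom(f) = S⁺_d and there exists k > 0 with f(A) ≤ k·tr(A) for all A ∈ S⁺_d. Let ψ be bounded upper semicontinuous on X with −ψ = (−ψ)^G. Then ψ is a viscosity supersolution of 1 − 𝒯(½∇²ψ) = 0 in Ω, where 𝒯(A) = sup { A:M : M ∈ S⁺⁺_d, f(M) = 1 }. -/
open MeasureTheory Set Filter Topology
open scoped ENNReal NNReal Classical

/-- Push-forward of a measure with a nonnegative density. -/
noncomputable def pushd {Y : Type*} [MeasurableSpace Y] {d : ℕ} (μ : Measure Y) (g : Y → ℝ)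
    (Φ : Y → Ed d) : Measure (Ed d) :=
  Measure.map Φ (μ.withDensity fun y => ENNReal.ofReal (g y))

lemma pushd_integral {Y : Type*} [MeasurableSpace Y] {d : ℕ} {μ : Measure Y} {g : Y → ℝ}
    {Φ : Y → Ed d} (hg : Measurable g) (hΦ : Measurable Φ) (h0 : ∀ᵐ y ∂μ, 0 ≤ g y)
    {F : Ed d → ℝ} (hF : Continuous F) :
    ∫ x, F x ∂(pushd μ g Φ) = ∫ y, g y * F (Φ y) ∂μ := by
  unfold pushd
  rw [integral_map hΦ.aemeasurable hF.aestronglyMeasurable,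
    integral_withDensity_eq_integral_toReal_smul hg.ennreal_ofReal (by simp)]
  refine integral_congr_ae ?_
  filter_upwards [h0] with y hy
  simp [ENNReal.toReal_ofReal hy]

lemma pushd_finite {Y : Type*} [MeasurableSpace Y] {d : ℕ} {μ : Measure Y} {g : Y → ℝ}
    {Φ : Y → Ed d} (hg : Integrable g μ) : IsFiniteMeasure (pushd μ g Φ) := by
  have : IsFiniteMeasure (μ.withDensity fun y => ENNReal.ofReal (g y)) :=
    isFiniteMeasure_withDensity_ofReal hg.2
  unfold pushd
  infer_instance

lemma pushd_compl {Y : Type*} [MeasurableSpace Y] {d : ℕ} {μ : Measure Y} {g : Y → ℝ}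
    {Φ : Y → Ed d} (hΦ : Measurable Φ) {X : Set (Ed d)} (hX : MeasurableSet X)
    (h : ∀ᵐ y ∂μ, Φ y ∈ X) : (pushd μ g Φ) Xᶜ = 0 := by
  unfold pushd
  rw [Measure.map_apply hΦ hX.compl]
  exact (withDensity_absolutelyContinuous μ _) (by rw [ae_iff] at h; exact h)

lemma pushd_univ {Y : Type*} [MeasurableSpace Y] {d : ℕ} {μ : Measure Y} {g : Y → ℝ}
    {Φ : Y → Ed d} (hg : Measurable g) (hΦ : Measurable Φ) (h0 : ∀ᵐ y ∂μ, 0 ≤ g y) :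
    (pushd μ g Φ).real univ = ∫ y, g y ∂μ := by
  have := pushd_integral (F := fun _ => (1 : ℝ)) hg hΦ h0 continuous_const
  simpa using this

/-- Second derivative along a pair of vectors. -/
noncomputable def D2 {d : ℕ} (φ : Ed d → ℝ) (y v w : Ed d) : ℝ :=
  fderiv ℝ (fderiv ℝ φ) y v w

lemma hess_eq {d : ℕ} (φ : Ed d → ℝ) (y : Ed d) (i j : Fin d) :
    hess φ y i j = D2 φ y (EuclideanSpace.single i 1) (EuclideanSpace.single j 1) := by
  simp [hess, D2, iteratedFDeriv_two_apply]

lemma frob_hess_vec_s16 {d : ℕ} (φ : Ed d → ℝ) (y v : Ed d) :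
    frob (hess φ y) (Matrix.vecMulVec v v) = D2 φ y v v := by
  have hv : v = ∑ i, v i • EuclideanSpace.single i (1 : ℝ) := by
    have := (EuclideanSpace.basisFun (Fin d) ℝ).sum_repr v
    simpa using this.symm
  have : D2 φ y v v = D2 φ y (∑ i, v i • EuclideanSpace.single i (1 : ℝ))
      (∑ i, v i • EuclideanSpace.single i (1 : ℝ)) := by rw [← hv]
  rw [this]
  simp only [frob, hess_eq, D2, map_sum, map_smul, sum_apply,
    smul_apply, smul_eq_mul, Matrix.vecMulVec_apply, Finset.mul_sum]
  rw [Finset.sum_comm]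
  refine Finset.sum_congr rfl fun i _ => Finset.sum_congr rfl fun j _ => by ring

lemma D2_continuous {d : ℕ} {φ : Ed d → ℝ} (hφ : ContDiff ℝ 2 φ) (v w : Ed d) :
    Continuous fun y => D2 φ y v w := by
  have h1 : ContDiff ℝ 1 (fderiv ℝ φ) := hφ.fderiv_right (by norm_num)
  have h2 : Continuous (fderiv ℝ (fderiv ℝ φ)) := h1.continuous_fderiv (by norm_num)
  exact (h2.clm_apply continuous_const).clm_apply continuous_const

lemma fd_hasFDerivAt {d : ℕ} {φ : Ed d → ℝ} (hφ : ContDiff ℝ 2 φ) (y : Ed d) :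
    HasFDerivAt (fderiv ℝ φ) (fderiv ℝ (fderiv ℝ φ) y) y := by
  have h1 : ContDiff ℝ 1 (fderiv ℝ φ) := hφ.fderiv_right (by norm_num)
  exact (h1.differentiable (by norm_num) y).hasFDerivAt

lemma line_hasDerivAt {d : ℕ} {φ : Ed d → ℝ} (hφ : ContDiff ℝ 2 φ) (x w : Ed d) (t : ℝ) :
    HasDerivAt (fun t : ℝ => φ (x + t • w)) (fderiv ℝ φ (x + t • w) w) t := by
  have hl : HasDerivAt (fun t : ℝ => x + t • w) w t := by
    simpa using ((hasDerivAt_id t).smul_const w).const_add x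
  exact ((hφ.differentiable (by norm_num) _).hasFDerivAt).comp_hasDerivAt t hl

lemma line_hasDerivAt2 {d : ℕ} {φ : Ed d → ℝ} (hφ : ContDiff ℝ 2 φ) (x w : Ed d) (t : ℝ) :
    HasDerivAt (fun t : ℝ => fderiv ℝ φ (x + t • w) w) (D2 φ (x + t • w) w w) t := by
  have hl : HasDerivAt (fun t : ℝ => x + t • w) w t := by
    simpa using ((hasDerivAt_id t).smul_const w).const_add x
  have := (fd_hasFDerivAt hφ (x + t • w)).comp_hasDerivAt t hl
  simpa [D2] using this.clm_apply (hasDerivAt_const t w)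

/-- Taylor formula along a segment. -/
lemma taylor_seg {d : ℕ} {φ : Ed d → ℝ} (hφ : ContDiff ℝ 2 φ) (x w : Ed d) :
    ∫ t in Icc (0:ℝ) 1, (1 - t) * D2 φ (x + t • w) w w
      = φ (x + w) - φ x - fderiv ℝ φ x w := by
  have hc : Continuous fun t : ℝ => D2 φ (x + t • w) w w :=
    (D2_continuous hφ w w).comp (by fun_prop)
  rw [integral_Icc_eq_integral_Ioc, ← intervalIntegral.integral_of_le zero_le_one]
  have key : ∀ t ∈ uIcc (0:ℝ) 1, HasDerivAt
      (fun t : ℝ => (1 - t) * fderiv ℝ φ (x + t • w) w + φ (x + t • w))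
      ((1 - t) * D2 φ (x + t • w) w w) t := by
    intro t _
    have h1 : HasDerivAt (fun t : ℝ => 1 - t) (-1) t := by
      simpa using (hasDerivAt_id t).const_sub 1
    have := (h1.mul (line_hasDerivAt2 hφ x w t)).add (line_hasDerivAt hφ x w t)
    refine this.congr_deriv ?_
    ring
  rw [intervalIntegral.integral_eq_sub_of_hasDerivAt key
    (Continuous.intervalIntegrable (by fun_prop) _ _)]
  simp
  ring

/-- Use of the `G`-transform equation with a constant-matrix competitor. -/
lemma key_ineq {d : ℕ} {f : Matd d → ℝ≥0∞} {X : Set (Ed d)} {ψ : Ed d → ℝ}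
    (hG : GEq f X (fun y => -ψ y) X) {x : Ed d} (hx : x ∈ X) {A : Matd d} (hA : A.PosSemidef)
    (hfA : f A ≠ ⊤) {m p : Measure (Ed d)} (hm : IsFiniteMeasure m) (hmX : m Xᶜ = 0)
    (hp : IsProbabilityMeasure p) (hpX : p Xᶜ = 0)
    (h : ∀ φ : Ed d → ℝ, IsC2c φ →
      ∫ y, (1/2 : ℝ) * frob (hess φ y) A ∂m = ∫ y, φ y ∂p - φ x) :
    ∫ y, ψ y ∂p ≤ ψ x + (f A).toReal * m.real univ := by
  have h1 : Gcost f X x p ≤ f A * m univ := by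
    unfold Gcost Fstat
    refine sInf_le ⟨m, fun _ => A, ⟨hm, hmX, fun _ => hA, ?_⟩, by simp⟩
    intro φ hφ
    rw [h φ hφ, integral_dirac]
  have h2 := hG x hx
  have h3 : GTrans f X (fun y => -ψ y) x ≤
      ((∫ y, -ψ y ∂p : ℝ) : EReal) + (Gcost f X x p : EReal) :=
    sInf_le ⟨p, hp, hpX, rfl⟩
  rw [h2] at h3
  have h4 : ((-ψ x : ℝ) : EReal) ≤ ((∫ y, -ψ y ∂p : ℝ) : EReal) +
      (((f A).toReal * m.real univ : ℝ) : EReal) := by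
    refine h3.trans (add_le_add le_rfl ?_)
    have : (f A).toReal * m.real univ = (f A * m univ).toReal := by
      rw [ENNReal.toReal_mul]; rfl
    rw [this, EReal.coe_ennreal_toReal (ENNReal.mul_ne_top hfA (measure_ne_top _ _))]
    exact_mod_cast h1
  rw [← EReal.coe_add, EReal.coe_le_coe_iff, integral_neg] at h4
  linarith

/-- The measure on the segment `[x, x+w]` with density `2(1-t)`. -/
noncomputable def segm {d : ℕ} (x w : Ed d) : Measure (Ed d) :=
  pushd (volume.restrict (Icc (0:ℝ) 1)) (fun t => 2 * (1 - t)) (fun t => x + t • w)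

lemma segm_integral {d : ℕ} (x w : Ed d) {F : Ed d → ℝ} (hF : Continuous F) :
    ∫ y, F y ∂(segm x w) = ∫ t in Icc (0:ℝ) 1, 2 * (1 - t) * F (x + t • w) := by
  refine pushd_integral (by fun_prop) (by fun_prop) ?_ hF
  filter_upwards [ae_restrict_mem measurableSet_Icc] with t ht
  nlinarith [ht.2]

instance segm_finite {d : ℕ} (x w : Ed d) : IsFiniteMeasure (segm x w) :=
  pushd_finite (Continuous.integrableOn_Icc (by fun_prop))

lemma segm_univ {d : ℕ} (x w : Ed d) : (segm x w).real univ = 1 := by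
  have := segm_integral x w (F := fun _ => (1:ℝ)) continuous_const
  rw [integral_const, smul_eq_mul, mul_one] at this
  rw [this, integral_Icc_eq_integral_Ioc, ← intervalIntegral.integral_of_le zero_le_one]
  simp only [mul_one, intervalIntegral.integral_const_mul]
  rw [intervalIntegral.integral_sub (by simp) (by simp)]
  simp
  norm_num

lemma segm_compl {d : ℕ} {X : Set (Ed d)} (hX : MeasurableSet X) (hc : Convex ℝ X)
    {x w : Ed d} (hx : x ∈ X) (hw : x + w ∈ X) : (segm x w) Xᶜ = 0 := by
  refine pushd_compl (by fun_prop) hX ?_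
  filter_upwards [ae_restrict_mem measurableSet_Icc] with t ht
  exact hc.add_smul_mem hx hw ht

lemma segm_test {d : ℕ} {φ : Ed d → ℝ} (hφ : ContDiff ℝ 2 φ) (x v : Ed d) (τ : ℝ) :
    τ ^ 2 * ∫ y, (1/2 : ℝ) * D2 φ y v v ∂(segm x (τ • v))
      = φ (x + τ • v) - φ x - τ * fderiv ℝ φ x v := by
  rw [segm_integral x _ ((D2_continuous hφ v v).const_mul _)]
  have := taylor_seg hφ x (τ • v)
  rw [map_smul, smul_eq_mul] at this
  rw [← this, ← integral_const_mul]
  refine integral_congr_ae (Eventually.of_forall fun t => ?_)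
  simp only [D2, map_smul, smul_apply, smul_eq_mul]
  ring

lemma integrable_of_cont_seg {d : ℕ} (x w : Ed d) {F : Ed d → ℝ} (hF : Continuous F) :
    Integrable F (segm x w) := by
  refine Integrable.of_bound (C := sSup ((fun t : ℝ => ‖F (x + t • w)‖) '' Icc (0:ℝ) 1))
    hF.aestronglyMeasurable ?_
  unfold segm pushd
  have hc : Continuous fun t : ℝ => ‖F (x + t • w)‖ := (hF.comp (by fun_prop)).norm
  refine (ae_map_iff (by fun_prop) ?_).2 ?_
  · exact measurableSet_le hF.norm.measurable measurable_const
  · refine (withDensity_absolutelyContinuous _ _).ae_le ?_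
    filter_upwards [ae_restrict_mem measurableSet_Icc] with t ht
    exact le_csSup (isCompact_Icc.image hc).bddAbove ⟨t, ht, rfl⟩

lemma seg_ineq {d : ℕ} {f : Matd d → ℝ≥0∞} {X : Set (Ed d)} {ψ : Ed d → ℝ}
    (hXm : MeasurableSet X) (hXc : Convex ℝ X) {k : ℝ} (hk : 0 < k)
    (hfk : ∀ A : Matd d, A.PosSemidef → f A ≤ ENNReal.ofReal (k * A.trace))
    (hG : GEq f X (fun y => -ψ y) X) {a b : Ed d} (ha : a ∈ X) (hb : b ∈ X)
    {α β : ℝ} (hα : 0 ≤ α) (hβ : 0 ≤ β) (hαβ : α + β = 1) :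
    α * ψ a + β * ψ b ≤ ψ (α • a + β • b) + k * (α * β * ‖b - a‖ ^ 2) := by
  set x := α • a + β • b with hxdef
  set v := b - a with hv
  have hx : x ∈ X := hXc ha hb hα hβ hαβ
  have ea : x + (-β) • v = a := by
    have : α = 1 - β := by linarith
    rw [hxdef, hv, this]; module
  have eb : x + α • v = b := by
    have : β = 1 - α := by linarith
    rw [hxdef, hv, this]; module
  have hA : (Matrix.vecMulVec v v : Matd d).PosSemidef := by
    simpa using Matrix.posSemidef_vecMulVec_self_star (v : Fin d → ℝ)
  have htr : (Matrix.vecMulVec v v : Matd d).trace = ‖v‖ ^ 2 := by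
    rw [EuclideanSpace.real_norm_sq_eq]
    simp [Matrix.trace, Matrix.vecMulVec_apply, sq]
  have hfA := hfk _ hA
  rw [htr] at hfA
  have hfin : f (Matrix.vecMulVec v v) ≠ ⊤ := ne_top_of_le_ne_top ENNReal.ofReal_ne_top hfA
  have hfr : (f (Matrix.vecMulVec v v)).toReal ≤ k * ‖v‖ ^ 2 :=
    ENNReal.toReal_le_of_le_ofReal (by positivity) hfA
  set p : Measure (Ed d) := α.toNNReal • Measure.dirac a + β.toNNReal • Measure.dirac b with hp
  set m : Measure (Ed d) := (α * β ^ 2).toNNReal • segm x ((-β) • v)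
    + (β * α ^ 2).toNNReal • segm x (α • v) with hm
  have hpi : ∀ g : Ed d → ℝ, ∫ y, g y ∂p = α * g a + β * g b := by
    intro g
    rw [hp, integral_add_measure, integral_smul_nnreal_measure, integral_smul_nnreal_measure,
      integral_dirac, integral_dirac]
    · simp [NNReal.smul_def, hα, hβ]
    · exact (integrable_dirac (by simp)).smul_measure_nnreal
    · exact (integrable_dirac (by simp)).smul_measure_nnreal
  have hmi : ∀ F : Ed d → ℝ, Continuous F → ∫ y, F y ∂m =
      (α * β ^ 2) * ∫ y, F y ∂(segm x ((-β) • v)) + (β * α ^ 2) * ∫ y, F y ∂(segm x (α • v)) := by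
    intro F hF
    have h1 : 0 ≤ α * β ^ 2 := by positivity
    have h2 : 0 ≤ β * α ^ 2 := by positivity
    rw [hm, integral_add_measure, integral_smul_nnreal_measure, integral_smul_nnreal_measure]
    · rw [NNReal.smul_def, NNReal.smul_def, Real.coe_toNNReal _ h1, Real.coe_toNNReal _ h2]
      rfl
    · exact (integrable_of_cont_seg _ _ hF).smul_measure_nnreal
    · exact (integrable_of_cont_seg _ _ hF).smul_measure_nnreal
  have hmf : IsFiniteMeasure m := by rw [hm]; infer_instance
  have hmu : m.real univ = α * β := by
    have := hmi (fun _ => 1) continuous_const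
    simp only [integral_const, smul_eq_mul, mul_one, segm_univ] at this
    rw [this]
    have : α = 1 - β := by linarith
    rw [this]; ring
  have hpp : IsProbabilityMeasure p := by
    constructor
    rw [hp]
    simp only [Measure.add_apply, Measure.smul_apply, measure_univ, ENNReal.smul_def,
      smul_eq_mul, mul_one]
    rw [← ENNReal.coe_add, ← Real.toNNReal_add hα hβ, hαβ]
    simp
  have := key_ineq hG hx hA hfin hmf ?_ hpp ?_ ?_ (m := m) (p := p)
  · rw [hpi, hmu] at this
    have h2 : 0 ≤ α * β := by positivity
    nlinarith [mul_le_mul_of_nonneg_right hfr h2]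
  · rw [hm]
    simp only [Measure.add_apply, Measure.smul_apply, smul_zero, add_zero,
      segm_compl hXm hXc hx (w := (-β) • v) (by rw [ea]; exact ha),
      segm_compl hXm hXc hx (w := α • v) (by rw [eb]; exact hb)]
  · rw [hp]
    simp [Measure.dirac_apply' _ hXm.compl, ha, hb]
  · intro φ hφ
    rw [hpi]
    simp only [frob_hess_vec_s16]
    rw [hmi _ ((D2_continuous hφ.1 v v).const_mul _)]
    have t1 := segm_test hφ.1 x v (-β)
    have t2 := segm_test hφ.1 x v α
    rw [ea] at t1
    rw [eb] at t2
    have : α = 1 - β := by linarith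
    have e3 : φ x = α * φ x + β * φ x := by rw [← add_mul, hαβ, one_mul]
    rw [neg_sq] at t1
    linear_combination α * t1 + β * t2 + e3

lemma psi_cont {d : ℕ} {f : Matd d → ℝ≥0∞} {Ω : Set (Ed d)} {ψ : Ed d → ℝ}
    (hΩopen : IsOpen Ω) (hΩconv : Convex ℝ Ω) {k : ℝ} (hk : 0 < k)
    (hfk : ∀ A : Matd d, A.PosSemidef → f A ≤ ENNReal.ofReal (k * A.trace))
    (hG : GEq f (closure Ω) (fun y => -ψ y) (closure Ω)) : ContinuousOn ψ Ω := by
  have hc : ConcaveOn ℝ Ω (fun y => ψ y - k * ‖y‖ ^ 2) := by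
    refine ⟨hΩconv, fun a ha b hb α β hα hβ hαβ => ?_⟩
    have := seg_ineq isClosed_closure.measurableSet hΩconv.closure hk hfk hG
      (subset_closure ha) (subset_closure hb) hα hβ hαβ
    have e : ‖α • a + β • b‖ ^ 2 = α * ‖a‖ ^ 2 + β * ‖b‖ ^ 2 - α * β * ‖b - a‖ ^ 2 := by
      rw [norm_add_sq_real, norm_sub_sq_real, norm_smul, norm_smul, inner_smul_left,
        inner_smul_right, real_inner_comm a b, Real.norm_of_nonneg hα, Real.norm_of_nonneg hβ]
      have : α = 1 - β := by linarith
      rw [this]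
      simp
      ring
    simp only [smul_eq_mul, e]
    nlinarith
  have := (hc.continuousOn hΩopen).add
    (continuous_const.mul (continuous_norm.pow 2) : Continuous fun y : Ed d => k * ‖y‖ ^ 2).continuousOn
  refine this.congr fun y _ => ?_
  simp

/-- The profile `(1-|z|²)₊`. -/
noncomputable def wf {d : ℕ} (z : Ed d) : ℝ := max 0 (1 - ‖z‖ ^ 2)

/-- The profile `(1-|z|²)₊²/4`. -/
noncomputable def ef {d : ℕ} (z : Ed d) : ℝ := (wf z) ^ 2 / 4

lemma wf_cont {d : ℕ} : Continuous (wf : Ed d → ℝ) := by unfold wf; fun_prop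

lemma ef_cont {d : ℕ} : Continuous (ef : Ed d → ℝ) := by
  unfold ef; exact (wf_cont.pow 2).div_const _

lemma wf_nonneg {d : ℕ} (z : Ed d) : 0 ≤ wf z := le_max_left _ _

lemma ef_nonneg {d : ℕ} (z : Ed d) : 0 ≤ ef z := by unfold ef; positivity

lemma wf_zero {d : ℕ} (z : Ed d) (hz : z ∉ Metric.closedBall (0 : Ed d) 1) : wf z = 0 := by
  rw [mem_closedBall_zero_iff, not_le] at hz
  unfold wf
  exact max_eq_left (by nlinarith)

lemma ef_zero {d : ℕ} (z : Ed d) (hz : z ∉ Metric.closedBall (0 : Ed d) 1) : ef z = 0 := by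
  simp [ef, wf_zero z hz]

lemma wf_supp {d : ℕ} : HasCompactSupport (wf : Ed d → ℝ) :=
  HasCompactSupport.intro (isCompact_closedBall _ _) wf_zero

lemma ef_supp {d : ℕ} : HasCompactSupport (ef : Ed d → ℝ) :=
  HasCompactSupport.intro (isCompact_closedBall _ _) ef_zero

lemma pos_sq_deriv (t : ℝ) : HasDerivAt (fun t : ℝ => (max 0 t) ^ 2 / 4) (max 0 t / 2) t := by
  rcases lt_trichotomy t 0 with h | h | h
  · have : (fun t : ℝ => (max 0 t) ^ 2 / 4) =ᶠ[𝓝 t] fun _ => 0 := by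
      filter_upwards [Iio_mem_nhds h] with u hu
      rw [max_eq_left (le_of_lt hu)]; simp
    rw [max_eq_left h.le, zero_div]
    exact (hasDerivAt_const t (0:ℝ)).congr_of_eventuallyEq this
  · subst h
    rw [hasDerivAt_iff_isLittleO]
    simp only [max_self, zero_div, smul_zero, sub_zero]
    have h2 : (fun u : ℝ => u ^ 2) =o[𝓝 0] fun u : ℝ => u := by
      simpa using (Asymptotics.isLittleO_pow_pow (𝕜 := ℝ) (m := 1) (n := 2) (by norm_num))
    refine Asymptotics.IsBigO.trans_isLittleO ?_ h2
    refine Asymptotics.IsBigO.of_bound 1 (Eventually.of_forall fun u => ?_)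
    have h0 : 0 ≤ (max 0 u) ^ 2 / 4 := by positivity
    have h1 : (max 0 u) ^ 2 ≤ u ^ 2 := by
      rcases le_total u 0 with h | h
      · rw [max_eq_left h]; nlinarith [sq_nonneg u]
      · rw [max_eq_right h]
    simp only [ne_eq, OfNat.ofNat_ne_zero, not_false_eq_true, zero_pow, zero_div, sub_zero,
      one_mul]
    rw [Real.norm_of_nonneg h0, Real.norm_of_nonneg (sq_nonneg u)]
    nlinarith [sq_nonneg (max 0 u)]
  · have : (fun t : ℝ => (max 0 t) ^ 2 / 4) =ᶠ[𝓝 t] fun t => t ^ 2 / 4 := by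
      filter_upwards [Ioi_mem_nhds h] with u hu
      rw [max_eq_right (le_of_lt hu)]
    rw [max_eq_right h.le]
    have h3 := ((hasDerivAt_pow 2 t).div_const 4).congr_of_eventuallyEq this
    refine h3.congr_deriv ?_
    simp; ring

lemma ef_line {d : ℕ} (z : Ed d) (k : Fin d) :
    HasLineDerivAt ℝ (ef : Ed d → ℝ) (-(z k * wf z)) z (EuclideanSpace.single k 1) := by
  have h1 : HasFDerivAt (fun z : Ed d => 1 - ‖z‖ ^ 2) (-(2 • innerSL ℝ z)) z :=
    (hasStrictFDerivAt_norm_sq z).hasFDerivAt.const_sub 1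
  have h2 := (pos_sq_deriv (1 - ‖z‖ ^ 2)).comp_hasFDerivAt z h1
  have h3 := h2.hasLineDerivAt (EuclideanSpace.single k 1)
  have hval : -(z k * wf z) = ((max 0 (1 - ‖z‖ ^ 2) / 2) • -(2 • innerSL ℝ z))
      (EuclideanSpace.single k 1) := by
    simp [wf, EuclideanSpace.inner_single_right]
    ring
  rw [hval]
  exact h3

/-- The linear map with columns `l k`. -/
noncomputable def Tm {d : ℕ} (l : Fin d → Ed d) : Ed d →L[ℝ] Ed d :=
  ∑ k, (EuclideanSpace.proj k : Ed d →L[ℝ] ℝ).smulRight (l k)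

lemma Tm_apply {d : ℕ} (l : Fin d → Ed d) (z : Ed d) : Tm l z = ∑ k, z k • l k := by
  simp [Tm, sum_apply]

lemma Tm_single {d : ℕ} (l : Fin d → Ed d) (k : Fin d) :
    Tm l (EuclideanSpace.single k 1) = l k := by
  rw [Tm_apply, Finset.sum_eq_single k]
  · simp
  · intro b _ hb; simp [hb]
  · simp

lemma ibp {d : ℕ} {φ : Ed d → ℝ} (hφ : ContDiff ℝ 2 φ) (x : Ed d) (l : Fin d → Ed d) (s : ℝ) :
    ∫ z, wf z * fderiv ℝ φ (x + s • Tm l z) (Tm l z)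
      = s * ∫ z, ef z * ∑ k, D2 φ (x + s • Tm l z) (l k) (l k) := by
  have hfc : Continuous (fderiv ℝ φ) := hφ.continuous_fderiv (by norm_num)
  have hΦ : Continuous fun z : Ed d => x + s • Tm l z := by fun_prop
  have hc1 : ∀ k, Continuous fun z => fderiv ℝ φ (x + s • Tm l z) (l k) := fun k =>
    (hfc.comp hΦ).clm_apply continuous_const
  have hc2 : ∀ k, Continuous fun z => D2 φ (x + s • Tm l z) (l k) (l k) := fun k =>
    (D2_continuous hφ (l k) (l k)).comp hΦ
  have hi1 : ∀ k, Integrable fun z : Ed d =>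
      fderiv ℝ φ (x + s • Tm l z) (l k) * (-(z k * wf z)) := by
    intro k
    have hcc : Continuous fun z : Ed d => fderiv ℝ φ (x + s • Tm l z) (l k) * (-(z k * wf z)) :=
      (hc1 k).mul (((by fun_prop : Continuous fun z : Ed d => z k).mul wf_cont).neg)
    refine hcc.integrable_of_hasCompactSupport ?_
    exact HasCompactSupport.intro (isCompact_closedBall (0 : Ed d) 1)
      fun z hz => by simp [wf_zero z hz]
  have hi2 : ∀ k, Integrable fun z : Ed d =>
      s * D2 φ (x + s • Tm l z) (l k) (l k) * ef z := by
    intro k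
    refine (((hc2 k).const_mul s).mul ef_cont).integrable_of_hasCompactSupport ?_
    exact HasCompactSupport.intro (isCompact_closedBall (0 : Ed d) 1)
      fun z hz => by simp [ef_zero z hz]
  have hi3 : ∀ k, Integrable fun z : Ed d =>
      fderiv ℝ φ (x + s • Tm l z) (l k) * ef z := by
    intro k
    refine ((hc1 k).mul ef_cont).integrable_of_hasCompactSupport ?_
    exact HasCompactSupport.intro (isCompact_closedBall (0 : Ed d) 1)
      fun z hz => by simp [ef_zero z hz]
  have hd : ∀ k, ∀ z : Ed d, HasLineDerivAt ℝ (fun z => fderiv ℝ φ (x + s • Tm l z) (l k))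
      (s * D2 φ (x + s • Tm l z) (l k) (l k)) z (EuclideanSpace.single k 1) := by
    intro k z
    have hl : HasFDerivAt (fun z : Ed d => x + s • Tm l z) (s • Tm l) z :=
      (((Tm l).hasFDerivAt).const_smul s).const_add x
    have h1 := (fd_hasFDerivAt hφ (x + s • Tm l z)).comp z hl
    have h3 : HasFDerivAt (fun z => fderiv ℝ φ (x + s • Tm l z) (l k)) _ z :=
      h1.clm_apply (hasFDerivAt_const (l k) z)
    have h4 := h3.hasLineDerivAt (EuclideanSpace.single k 1)
    simp only [add_apply, ContinuousLinearMap.comp_apply, ContinuousLinearMap.flip_apply,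
      zero_apply, map_zero, zero_add, smul_apply, Tm_single, map_smul, smul_eq_mul] at h4
    exact h4
  have key : ∀ k, ∫ z, fderiv ℝ φ (x + s • Tm l z) (l k) * (-(z k * wf z))
      = - ∫ z, s * D2 φ (x + s • Tm l z) (l k) (l k) * ef z := fun k =>
    integral_bilinear_hasLineDerivAt_right_eq_neg_left_of_integrable
      (B := ContinuousLinearMap.mul ℝ ℝ) (hi2 k) (hi1 k) (hi3 k)
      (fun z _ => hd k z) (fun z _ => ef_line z k)
  calc ∫ z, wf z * fderiv ℝ φ (x + s • Tm l z) (Tm l z)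
      = ∫ z, ∑ k, -(fderiv ℝ φ (x + s • Tm l z) (l k) * (-(z k * wf z))) := by
        refine integral_congr_ae (Eventually.of_forall fun z => ?_)
        have : fderiv ℝ φ (x + s • Tm l z) (Tm l z)
            = ∑ k, z k * fderiv ℝ φ (x + s • Tm l z) (l k) := by
          conv_lhs => rw [Tm_apply l z, map_sum]
          simp [Tm_apply]
        simp only [this, Finset.mul_sum]
        exact Finset.sum_congr rfl fun k _ => by ring
    _ = ∑ k, ∫ z, s * D2 φ (x + s • Tm l z) (l k) (l k) * ef z := by
        rw [integral_finsetSum _ fun k _ => by exact (hi1 k).neg]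
        refine Finset.sum_congr rfl fun k _ => ?_
        rw [integral_neg, key k, neg_neg]
    _ = ∫ z, ∑ k, s * D2 φ (x + s • Tm l z) (l k) (l k) * ef z :=
        (integral_finsetSum _ fun k _ => hi2 k).symm
    _ = _ := by
        rw [← integral_const_mul]
        refine integral_congr_ae (Eventually.of_forall fun z => ?_)
        simp only [Finset.mul_sum]
        exact Finset.sum_congr rfl fun k _ => by ring

/-- Main identity. -/
lemma ball_identity {d : ℕ} {φ : Ed d → ℝ} (hφ : ContDiff ℝ 2 φ) (x : Ed d) (l : Fin d → Ed d) :
    ∫ z in Metric.closedBall (0 : Ed d) 1, wf z * (φ (x + Tm l z) - φ x)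
      = ∫ s in Icc (0:ℝ) 1, ∫ z in Metric.closedBall (0 : Ed d) 1,
          s * (ef z * ∑ k, D2 φ (x + s • Tm l z) (l k) (l k)) := by
  have hfc : Continuous (fderiv ℝ φ) := hφ.continuous_fderiv (by norm_num)
  have e1 : ∀ s : ℝ, ∫ z in Metric.closedBall (0 : Ed d) 1,
      s * (ef z * ∑ k, D2 φ (x + s • Tm l z) (l k) (l k))
      = ∫ z in Metric.closedBall (0 : Ed d) 1,
        wf z * fderiv ℝ φ (x + s • Tm l z) (Tm l z) := by
    intro s
    rw [setIntegral_eq_integral_of_forall_compl_eq_zero (fun z hz => by simp [ef_zero z hz]),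
      setIntegral_eq_integral_of_forall_compl_eq_zero (fun z hz => by simp [wf_zero z hz]),
      ibp hφ, integral_const_mul]
  simp only [e1]
  rw [integral_integral_swap]
  · refine integral_congr_ae (Eventually.of_forall fun z => ?_)
    simp only
    rw [integral_const_mul]
    congr 1
    rw [integral_Icc_eq_integral_Ioc, ← intervalIntegral.integral_of_le zero_le_one,
      intervalIntegral.integral_eq_sub_of_hasDerivAt
        (fun t _ => line_hasDerivAt hφ x (Tm l z) t)]
    · simp
    · refine Continuous.intervalIntegrable ?_ _ _
      exact (hfc.comp (by fun_prop)).clm_apply continuous_const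
  · rw [Measure.prod_restrict]
    refine ContinuousOn.integrableOn_compact
      (isCompact_Icc.prod (isCompact_closedBall _ _)) (Continuous.continuousOn ?_)
    refine (wf_cont.comp continuous_snd).mul ?_
    exact (hfc.comp (by fun_prop)).clm_apply (by fun_prop)

lemma frob_sum {d : ℕ} (H : Matd d) (l : Fin d → Ed d) :
    frob H (∑ k, Matrix.vecMulVec (l k) (l k)) = ∑ k, frob H (Matrix.vecMulVec (l k) (l k)) := by
  simp only [frob, Matrix.sum_apply, Finset.mul_sum]
  rw [Finset.sum_comm_cycle]

lemma ball_competitor {d : ℕ} (x : Ed d) (l : Fin d → Ed d) (K : Set (Ed d))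
    (hK : MeasurableSet K) (h : ∀ s ∈ Icc (0:ℝ) 1, ∀ z ∈ Metric.closedBall (0 : Ed d) 1,
      x + s • Tm l z ∈ K) :
    ∃ m p : Measure (Ed d), IsFiniteMeasure m ∧ m Kᶜ = 0 ∧ IsProbabilityMeasure p ∧ p Kᶜ = 0 ∧
      0 < m.real univ ∧
      ∀ φ : Ed d → ℝ, ContDiff ℝ 2 φ →
        ∫ y, (1/2 : ℝ) * frob (hess φ y) (∑ k, Matrix.vecMulVec (l k) (l k)) ∂m
          = ∫ y, φ y ∂p - φ x := by
  set μz : Measure (Ed d) := volume.restrict (Metric.closedBall (0 : Ed d) 1) with hμz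
  set μs : Measure ℝ := volume.restrict (Icc (0:ℝ) 1) with hμs
  set Z : ℝ := ∫ z, wf z ∂μz with hZ
  have hwi : Integrable (wf : Ed d → ℝ) μz :=
    (wf_cont.integrable_of_hasCompactSupport wf_supp).restrict
  have hei : Integrable (ef : Ed d → ℝ) μz :=
    (ef_cont.integrable_of_hasCompactSupport ef_supp).restrict
  have hZpos : 0 < Z := by
    rw [hZ, hμz, setIntegral_eq_integral_of_forall_compl_eq_zero wf_zero]
    exact wf_cont.integral_pos_of_hasCompactSupport_nonneg_nonzero wf_supp
      (fun z => wf_nonneg z) (x := 0) (by simp [wf])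
  have hEpos : 0 < ∫ z, ef z ∂μz := by
    rw [hμz, setIntegral_eq_integral_of_forall_compl_eq_zero ef_zero]
    exact ef_cont.integral_pos_of_hasCompactSupport_nonneg_nonzero ef_supp
      (fun z => ef_nonneg z) (x := 0) (by simp [ef, wf])
  have hs : ∀ᵐ q ∂(μs.prod μz), q ∈ Icc (0:ℝ) 1 ×ˢ Metric.closedBall (0 : Ed d) 1 := by
    rw [hμs, hμz, Measure.prod_restrict]
    exact ae_restrict_mem (measurableSet_Icc.prod Metric.isClosed_closedBall.measurableSet)
  have hgc : Continuous fun q : ℝ × Ed d => 2 * q.1 * (ef q.2 / Z) :=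
    (continuous_const.mul continuous_fst).mul ((ef_cont.comp continuous_snd).div_const _)
  have hg0 : ∀ᵐ q ∂(μs.prod μz), 0 ≤ 2 * q.1 * (ef q.2 / Z) := by
    filter_upwards [hs] with q hq
    have := hq.1.1
    have := ef_nonneg q.2
    positivity
  have hΦ : Continuous fun q : ℝ × Ed d => x + q.1 • Tm l q.2 := by fun_prop
  have hw0 : ∀ᵐ z ∂μz, 0 ≤ wf z / Z :=
    Eventually.of_forall fun z => div_nonneg (wf_nonneg z) hZpos.le
  have hwm : Measurable fun z : Ed d => wf z / Z := (wf_cont.div_const _).measurable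
  have hΨ : Measurable fun z : Ed d => x + Tm l z := by fun_prop
  refine ⟨pushd (μs.prod μz) (fun q => 2 * q.1 * (ef q.2 / Z)) (fun q => x + q.1 • Tm l q.2),
    pushd μz (fun z => wf z / Z) (fun z => x + Tm l z), ?_, ?_, ?_, ?_, ?_, ?_⟩
  · refine pushd_finite ?_
    rw [hμs, hμz, Measure.prod_restrict]
    exact hgc.continuousOn.integrableOn_compact (isCompact_Icc.prod (isCompact_closedBall _ _))
  · refine pushd_compl hΦ.measurable hK ?_
    filter_upwards [hs] with q hq
    exact h q.1 hq.1 q.2 hq.2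
  · have hf : IsFiniteMeasure (pushd μz (fun z => wf z / Z) (fun z => x + Tm l z)) :=
      pushd_finite (hwi.div_const _)
    have := pushd_univ hwm hΨ hw0
    rw [integral_div, ← hZ, div_self hZpos.ne'] at this
    constructor
    rw [← ENNReal.toReal_eq_one_iff]
    exact this
  · refine pushd_compl hΨ hK ?_
    filter_upwards [ae_restrict_mem Metric.isClosed_closedBall.measurableSet] with z hz
    simpa using h 1 (by simp) z hz
  · rw [pushd_univ hgc.measurable hΦ.measurable hg0,
      integral_prod_mul (fun s : ℝ => 2 * s) (fun z : Ed d => ef z / Z)]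
    have h1 : ∫ s, 2 * s ∂μs = 1 := by
      rw [hμs, integral_Icc_eq_integral_Ioc, ← intervalIntegral.integral_of_le zero_le_one,
        intervalIntegral.integral_const_mul, integral_id]
      norm_num
    rw [h1, integral_div]
    positivity
  · intro φ hφ
    simp only [frob_sum, frob_hess_vec_s16]
    have hDc : Continuous fun y => ∑ k, D2 φ y (l k) (l k) :=
      continuous_finsetSum _ fun k _ => D2_continuous hφ _ _
    rw [pushd_integral hgc.measurable hΦ.measurable hg0 (hDc.const_mul _),
      pushd_integral hwm hΨ hw0 hφ.continuous, integral_prod]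
    · have hid := ball_identity hφ x l
      rw [← hμz, ← hμs] at hid
      have e1 : ∫ z, wf z / Z * φ (x + Tm l z) ∂μz - φ x
          = (∫ z, wf z * (φ (x + Tm l z) - φ x) ∂μz) / Z := by
        simp only [mul_sub]
        rw [integral_sub, integral_mul_const, ← hZ, sub_div, mul_div_cancel_left₀ _ hZpos.ne',
          ← integral_div]
        · congr 2
          ext z
          ring
        · rw [hμz]
          exact (Continuous.continuousOn (wf_cont.mul
            (hφ.continuous.comp (by fun_prop)))).integrableOn_compact (isCompact_closedBall _ _)
        · exact hwi.mul_const _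
      rw [e1, hid, ← integral_div]
      congr 1
      ext s
      rw [← integral_div]
      congr 1
      ext z
      ring
    · rw [hμs, hμz, Measure.prod_restrict]
      exact (Continuous.continuousOn (hgc.mul
        ((hDc.const_mul _).comp hΦ))).integrableOn_compact
        (isCompact_Icc.prod (isCompact_closedBall _ _))

lemma integrable_of_contOn {d : ℕ} {K : Set (Ed d)} (hK : IsCompact K) {p : Measure (Ed d)}
    [IsFiniteMeasure p] (hp : p Kᶜ = 0) {F : Ed d → ℝ} (hF : ContinuousOn F K) :
    Integrable F p := by
  have h : p.restrict K = p := Measure.restrict_eq_self_of_ae_mem (by rw [ae_iff]; exact hp)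
  have := hF.integrableOn_compact (μ := p) hK
  rwa [IntegrableOn, h] at this

open scoped MatrixOrder in
lemma posSemidef_decomp {d : ℕ} {M : Matd d} (hM : M.PosSemidef) :
    ∃ l : Fin d → Ed d, M = ∑ k, Matrix.vecMulVec (l k) (l k) := by
  obtain ⟨B, hB⟩ := CStarAlgebra.nonneg_iff_eq_star_mul_self.1 hM.nonneg
  refine ⟨fun k => WithLp.toLp 2 (B k), ?_⟩
  rw [hB]
  ext i j
  simp [Matrix.mul_apply, Matrix.sum_apply, Matrix.vecMulVec_apply, Matrix.star_apply]

lemma Tm_smul {d : ℕ} (l : Fin d → Ed d) (R : ℝ) (z : Ed d) :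
    Tm (fun k => R • l k) z = R • Tm l z := by
  simp only [Tm_apply, Finset.smul_sum]
  exact Finset.sum_congr rfl fun k _ => smul_comm _ _ _

lemma visc_main {d : ℕ} {f : Matd d → ℝ≥0∞} (hA1 : CostA1 f) {Ω X : Set (Ed d)}
    (hΩopen : IsOpen Ω) (hΩX : Ω ⊆ X) {ψ : Ed d → ℝ} (hψ : ContinuousOn ψ Ω)
    (hG : GEq f X (fun y => -ψ y) X) : IsViscSupersol f 1 ψ Ω := by
  intro φ hφ x hx hmin
  refine sSup_le ?_
  rintro _ ⟨M, hM, hfM, rfl⟩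
  refine EReal.coe_le_coe_iff.2 ?_
  by_contra! hgt
  -- localisation
  obtain ⟨r₀, hr₀, hball₀⟩ := Metric.isOpen_iff.1 hΩopen x hx
  let χ : ContDiffBump x := ⟨r₀ / 4, r₀ / 2, by positivity, by linarith⟩
  set Φ : Ed d → ℝ := fun y => χ y * φ y with hΦdef
  have hsupp : tsupport χ ⊆ Ω := by
    rw [χ.tsupport_eq]
    exact (Metric.closedBall_subset_ball (by change r₀ / 2 < r₀; linarith)).trans hball₀
  have hΦ2 : ContDiff ℝ 2 Φ := by
    rw [contDiff_iff_contDiffAt]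
    intro y
    by_cases hy : y ∈ Ω
    · exact χ.contDiffAt.mul (hφ.contDiffAt (hΩopen.mem_nhds hy))
    · have hy' : y ∉ tsupport χ := fun h => hy (hsupp h)
      have : Φ =ᶠ[𝓝 y] fun _ => 0 := by
        filter_upwards [notMem_tsupport_iff_eventuallyEq.1 hy'] with u hu
        simp [hΦdef, hu]
      exact contDiffAt_const.congr_of_eventuallyEq this
  have heq : Φ =ᶠ[𝓝 x] φ := by
    filter_upwards [χ.eventuallyEq_one] with u hu
    simp [hΦdef, hu]
  have hhess : hess Φ x = hess φ x := by
    unfold hess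
    rw [(heq.iteratedFDeriv ℝ 2).eq_of_nhds]
  obtain ⟨l₀, hl₀⟩ := posSemidef_decomp hM.posSemidef
  set g : Ed d → ℝ := fun y => (1/2 : ℝ) * frob (hess Φ y) M with hg
  have hgc : Continuous g := by
    simp only [hg, hl₀, frob_sum, frob_hess_vec_s16]
    exact (continuous_finsetSum _ fun k _ => D2_continuous hΦ2 _ _).const_mul _
  have hgx : 1 < g x := by
    have : frob ((1/2 : ℝ) • hess φ x) M = g x := by
      simp only [hg, hhess, frob, Matrix.smul_apply, smul_eq_mul, Finset.mul_sum, mul_assoc]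
    rwa [← this]
  obtain ⟨c, hc1, hcg⟩ := exists_between hgx
  have hmin' : ∀ᶠ y in 𝓝 x, ψ x - φ x ≤ ψ y - φ y := by
    have := hmin
    rw [IsLocalMinOn, IsMinFilter, hΩopen.nhdsWithin_eq hx] at this
    exact this
  have hΩev : ∀ᶠ y in 𝓝 x, y ∈ Ω := hΩopen.mem_nhds hx
  have hev : ∀ᶠ y in 𝓝 x, c < g y ∧ y ∈ Ω ∧ Φ y = φ y ∧ ψ x - φ x ≤ ψ y - φ y :=
    (hgc.continuousAt.eventually (lt_mem_nhds hcg)).and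
      (hΩev.and (heq.and hmin'))
  obtain ⟨r, hr, hrb⟩ := Metric.nhds_basis_closedBall.eventually_iff.1 hev
  set R : ℝ := r / (‖Tm l₀‖ + 1) with hR
  have hRpos : 0 < R := by positivity
  have hRr : R * ‖Tm l₀‖ ≤ r := by
    have : R * (‖Tm l₀‖ + 1) = r := by rw [hR]; field_simp
    nlinarith
  set l : Fin d → Ed d := fun k => R • l₀ k with hl
  have hA : ∑ k, Matrix.vecMulVec (l k) (l k) = (R ^ 2) • M := by
    rw [hl₀, Finset.smul_sum]
    refine Finset.sum_congr rfl fun k _ => ?_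
    ext i j
    simp [hl, Matrix.vecMulVec_apply]
    ring
  obtain ⟨m, p, hmf, hmK, hpp, hpK, hmpos, htest⟩ :=
    ball_competitor x l (Metric.closedBall x r) Metric.isClosed_closedBall.measurableSet (by
      intro s hs z hz
      rw [mem_closedBall_iff_norm, add_sub_cancel_left, hl, Tm_smul, norm_smul, norm_smul,
        Real.norm_of_nonneg hs.1, Real.norm_of_nonneg hRpos.le]
      rw [mem_closedBall_zero_iff] at hz
      have h1 : ‖Tm l₀ z‖ ≤ ‖Tm l₀‖ := by
        refine ((Tm l₀).le_opNorm z).trans ?_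
        nlinarith [norm_nonneg (Tm l₀)]
      have h2 : R * ‖Tm l₀ z‖ ≤ r := (mul_le_mul_of_nonneg_left h1 hRpos.le).trans hRr
      have h3 : 0 ≤ R * ‖Tm l₀ z‖ := by positivity
      nlinarith [hs.2])
  rw [hA] at htest
  have hKX : (Metric.closedBall x r) ⊆ X := fun y hy => hΩX (hrb hy).2.1
  have hfA : f ((R ^ 2) • M) = ENNReal.ofReal (R ^ 2) := by
    rw [hA1.2.2.2 _ (by positivity), hfM, mul_one]
  have hkey := key_ineq hG (hΩX hx) (A := (R ^ 2) • M)
    (hM.posSemidef.smul (by positivity)) (by rw [hfA]; exact ENNReal.ofReal_ne_top) hmf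
    (measure_mono_null (compl_subset_compl.2 hKX) hmK) hpp
    (measure_mono_null (compl_subset_compl.2 hKX) hpK) (fun φ' h => htest φ' h.1)
  rw [hfA, ENNReal.toReal_ofReal (by positivity)] at hkey
  have hKc : IsCompact (Metric.closedBall x r) := isCompact_closedBall _ _
  have hΦi : Integrable Φ p := integrable_of_contOn hKc hpK hΦ2.continuous.continuousOn
  have hψi : Integrable ψ p :=
    integrable_of_contOn hKc hpK (hψ.mono fun y hy => (hrb hy).2.1)
  have hgi : Integrable g m := integrable_of_contOn hKc hmK hgc.continuousOn
  have hΦx : Φ x = φ x := heq.eq_of_nhds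
  have h1 : ∫ y, Φ y ∂p + (ψ x - φ x) ≤ ∫ y, ψ y ∂p := by
    have : ∫ y, (Φ y + (ψ x - φ x)) ∂p = ∫ y, Φ y ∂p + (ψ x - φ x) := by
      rw [integral_add hΦi (integrable_const _)]; simp
    rw [← this]
    refine integral_mono_ae (hΦi.add (integrable_const _)) hψi ?_
    have : ∀ᵐ y ∂p, y ∈ Metric.closedBall x r := by rw [ae_iff]; exact hpK
    filter_upwards [this] with y hy
    have := hrb hy
    linarith [this.2.2.1, this.2.2.2]
  have h2 : R ^ 2 * (c * m.real univ) ≤ ∫ y, Φ y ∂p - Φ x := by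
    rw [← htest Φ hΦ2]
    have e : ∀ y, (1/2 : ℝ) * frob (hess Φ y) ((R ^ 2) • M) = R ^ 2 * g y := by
      intro y
      simp only [hg, frob, Matrix.smul_apply, smul_eq_mul, Finset.mul_sum]
      refine Finset.sum_congr rfl fun i _ => Finset.sum_congr rfl fun j _ => by ring
    simp only [e]
    rw [integral_const_mul]
    refine mul_le_mul_of_nonneg_left ?_ (by positivity)
    have : ∫ _, c ∂m = c * m.real univ := by simp [mul_comm]
    rw [← this]
    refine integral_mono_ae (integrable_const _) hgi ?_
    have : ∀ᵐ y ∂m, y ∈ Metric.closedBall x r := by rw [ae_iff]; exact hmK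
    filter_upwards [this] with y hy
    exact (hrb hy).1.le
  have h3 : R ^ 2 * m.real univ < R ^ 2 * (c * m.real univ) := by
    have : 0 < R ^ 2 * m.real univ := by positivity
    nlinarith
  linarith

/-- Proposition 4.10. Under (A3), if `ψ ∈ U_b(X)` satisfies
`−ψ = (−ψ)^G`, then `ψ` is a viscosity supersolution of `1 − 𝒯(½∇²ψ) = 0` in `Ω`. -/
theorem stmt16 {d : ℕ} (hd : 0 < d) (f : Matd d → ℝ≥0∞) (hA1 : CostA1 f) (hA2 : CostA2 f)
    (Ω X : Set (Ed d)) (hΩopen : IsOpen Ω) (hΩconv : Convex ℝ Ω)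
    (hΩbdd : Bornology.IsBounded Ω) (hΩne : Ω.Nonempty) (hX : X = closure Ω)
    (hA3 : (∀ M : Matd d, f M ≠ ⊤ ↔ M.PosSemidef) ∧
      ∃ k : ℝ, 0 < k ∧ ∀ A : Matd d, A.PosSemidef → f A ≤ ENNReal.ofReal (k * A.trace))
    (ψ : Ed d → ℝ) (hbdd : ∃ C : ℝ, ∀ x ∈ X, |ψ x| ≤ C)
    (husc : UpperSemicontinuousOn ψ X) (hG : GEq f X (fun y => -ψ y) X) :
    LowerSemicontinuousOn ψ Ω ∧ IsViscSupersol f 1 ψ Ω := by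
  obtain ⟨k, hk, hfk⟩ := hA3.2
  subst hX
  have hψ : ContinuousOn ψ Ω := psi_cont hΩopen hΩconv hk hfk hG
  exact ⟨hψ.lowerSemicontinuousOn, visc_main hA1 hΩopen subset_closure hψ hG⟩
end

section
/- Let U ⊂ ℝ^d be open, c ∈ ℝ, and let w ∈ L¹_loc(ℝ^d) be lower semicontinuous on U and a viscosity supersolution of c − 𝒯(½∇²w) = 0 in U, where 𝒯(A) = sup { A:M : M ∈ S⁺⁺_d, f(M) = 1 }. Then for each sufficiently small ε > 0, the mollification w_ε = w * η_ε satisfies c − 𝒯(½∇²w_ε(x)) ≥ 0 pointwise for every x ∈ U_ε = { x ∈ U : dist(x, ∂U) > ε }. -/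
open MeasureTheory Set Filter Topology
open scoped ENNReal NNReal Classical

namespace Stmt17

open scoped SchwartzMap LineDeriv FourierTransform ContDiff


/-- The operator `∑ₖ D²φ(x)(bₖ, bₖ)`. -/
noncomputable def Lb {d m : ℕ} (b : Fin m → Ed d) (φ : Ed d → ℝ) (x : Ed d) : ℝ :=
  ∑ k, iteratedFDeriv ℝ 2 φ x ![b k, b k]

/-- The operator on Schwartz functions. -/
noncomputable def LS {d m : ℕ} {F : Type*} [NormedAddCommGroup F] [NormedSpace ℝ F]
    (b : Fin m → Ed d) (f : 𝓢(Ed d, F)) : 𝓢(Ed d, F) :=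
  ∑ k, ∂_{b k} (∂_{b k} f)

lemma LS_apply {d m : ℕ} (b : Fin m → Ed d) (f : 𝓢(Ed d, ℝ)) (x : Ed d) :
    LS b f x = Lb b f x := by
  unfold LS Lb
  rw [_root_.sum_apply]
  refine Finset.sum_congr rfl fun k _ => ?_
  rw [← SchwartzMap.iteratedLineDerivOp_eq_iteratedFDeriv]
  simp [LineDeriv.iteratedLineDerivOp_succ_left]

lemma posSemidef_decomp {d : ℕ} (M : Matd d) (hM : M.PosSemidef) :
    ∃ (m : ℕ) (b : Fin m → Ed d), ∀ φ : Ed d → ℝ, ∀ x, frob (hess φ x) M = Lb b φ x := by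
  obtain ⟨m, v, hv⟩ := Matrix.posSemidef_iff_eq_sum_vecMulVec.mp hM
  refine ⟨m, fun k => WithLp.toLp 2 (v k), fun φ x => ?_⟩
  unfold frob Lb hess
  have h1 : ∀ k, iteratedFDeriv ℝ 2 φ x ![WithLp.toLp 2 (v k), WithLp.toLp 2 (v k)] =
      ∑ i, ∑ j, v k i * v k j * iteratedFDeriv ℝ 2 φ x
        ![EuclideanSpace.single i 1, EuclideanSpace.single j 1] := by
    intro k
    have hb : (WithLp.toLp 2 (v k) : Ed d) = ∑ i, v k i • EuclideanSpace.single i (1:ℝ) := by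
      ext j
      simp [Finset.sum_apply, Pi.single_apply]
    have h2 : ∀ y z : Ed d, iteratedFDeriv ℝ 2 φ x ![y, z] =
        fderiv ℝ (fderiv ℝ φ) x y z := by
      intro y z
      rw [iteratedFDeriv_two_apply]; simp
    simp only [h2]
    rw [hb]
    simp only [map_sum, map_smul, _root_.sum_apply, _root_.smul_apply, smul_eq_mul]
    simp only [Finset.mul_sum]
    rw [Finset.sum_comm]
    refine Finset.sum_congr rfl fun i _ => Finset.sum_congr rfl fun j _ => ?_
    ring
  simp only [h1]
  rw [hv]
  simp only [Matrix.sum_apply, Matrix.vecMulVec_apply, Finset.mul_sum]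
  rw [Finset.sum_comm (s := (Finset.univ : Finset (Fin m)))]
  refine Finset.sum_congr rfl fun i _ => ?_
  rw [Finset.sum_comm (s := (Finset.univ : Finset (Fin m)))]
  refine Finset.sum_congr rfl fun j _ => Finset.sum_congr rfl fun k _ => ?_
  simp only [Pi.star_apply, star_trivial]
  ring

lemma LS_selfadj {d m : ℕ} (b : Fin m → Ed d) (f g : 𝓢(Ed d, ℝ)) :
    ∫ x, f x * LS b g x = ∫ x, LS b f x * g x := by
  unfold LS
  simp only [_root_.sum_apply, Finset.mul_sum, Finset.sum_mul]
  rw [integral_finsetSum, integral_finsetSum]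
  · refine Finset.sum_congr rfl fun k _ => ?_
    rw [SchwartzMap.integral_mul_lineDerivOp_right_eq_neg_left,
      SchwartzMap.integral_mul_lineDerivOp_right_eq_neg_left, neg_neg]
  · intro k _
    exact (SchwartzMap.pairing (ContinuousLinearMap.mul ℝ ℝ) (∂_{b k} (∂_{b k} f)) g).integrable
  · intro k _
    exact (SchwartzMap.pairing (ContinuousLinearMap.mul ℝ ℝ) f (∂_{b k} (∂_{b k} g))).integrable

lemma LS_multiplier {d m : ℕ} (b : Fin m → Ed d) (f : 𝓢(Ed d, ℂ)) :
    LS b f = SchwartzMap.fourierMultiplierCLM ℂ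
      (fun ξ => - (2 * Real.pi) ^ 2 * ∑ k, (inner ℝ ξ (b k)) ^ 2 : Ed d → ℝ) f := by
  have h : ∀ k (hk : k ∈ Finset.univ), (fun ξ : Ed d => - (2 * Real.pi) ^ 2 * (inner ℝ ξ (b k)) ^ 2).HasTemperateGrowth := by
    intro k _
    fun_prop
  simp only [Finset.mul_sum]
  rw [SchwartzMap.fourierMultiplierCLM_sum ℂ h]
  unfold LS
  simp only [_root_.sum_apply]
  refine Finset.sum_congr rfl fun k _ => ?_
  rw [SchwartzMap.lineDeriv_eq_fourierMultiplierCLM, SchwartzMap.lineDeriv_eq_fourierMultiplierCLM]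
  have h1 : (fun ξ : Ed d => inner ℝ ξ (b k)).HasTemperateGrowth := by fun_prop
  have h2 : (fun ξ : Ed d => (inner ℝ ξ (b k)) ^ 2).HasTemperateGrowth := by fun_prop
  have h3 : (fun ξ : Ed d => - (2 * Real.pi) ^ 2 * (inner ℝ ξ (b k)) ^ 2) =
      (- (2 * Real.pi) ^ 2 : ℝ) • (fun ξ : Ed d => (inner ℝ ξ (b k)) ^ 2) := by
    ext ξ; simp
  have h4 : ((fun ξ : Ed d => inner ℝ ξ (b k)) * (fun ξ : Ed d => inner ℝ ξ (b k))) =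
      (fun ξ : Ed d => (inner ℝ ξ (b k)) ^ 2) := by
    ext ξ; simp [sq]
  have h5 : ∀ (z : ℂ) (g : 𝓢(Ed d, ℂ)), SchwartzMap.fourierMultiplierCLM ℂ
      (fun ξ : Ed d => inner ℝ ξ (b k)) (z • g) = z • SchwartzMap.fourierMultiplierCLM ℂ
      (fun ξ : Ed d => inner ℝ ξ (b k)) g := by
    intro z g
    rw [← SchwartzMap.fourierMultiplierCLM_ofReal ℂ h1, map_smul,
      SchwartzMap.fourierMultiplierCLM_ofReal ℂ h1]
  rw [h5, SchwartzMap.fourierMultiplierCLM_fourierMultiplierCLM_apply h1 h1, h4, h3,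
    SchwartzMap.fourierMultiplierCLM_smul h2]
  ext x
  simp only [_root_.smul_apply, _root_.smul_apply, smul_eq_mul,
    Complex.real_smul]
  push_cast
  linear_combination (4 * (Real.pi:ℂ)^2 * (SchwartzMap.fourierMultiplierCLM ℂ
      (fun ξ : Ed d => (inner ℝ ξ (b k)) ^ 2) f) x) * Complex.I_sq

lemma resolvent_C {d m : ℕ} (b : Fin m → Ed d) (t : ℝ) (ht : 0 < t) (g : 𝓢(Ed d, ℂ)) :
    ∃ u : 𝓢(Ed d, ℂ), u - t • LS b u = g := by
  set q : Ed d → ℝ := fun ξ => - (2 * Real.pi) ^ 2 * ∑ k, (inner ℝ ξ (b k)) ^ 2 with hq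
  have hqt : q.HasTemperateGrowth := by
    rw [hq]; fun_prop
  have hrt : (fun ξ => (1 - t * q ξ)⁻¹).HasTemperateGrowth := by
    let C : Ed d →L[ℝ] EuclideanSpace ℝ (Fin m) :=
      ((EuclideanSpace.equiv (Fin m) ℝ).symm : (Fin m → ℝ) →L[ℝ] EuclideanSpace ℝ (Fin m)).comp
      (ContinuousLinearMap.pi fun k => (Real.sqrt t * (2 * Real.pi)) • (innerSL ℝ (b k)))
    have h := (Function.hasTemperateGrowth_one_add_norm_sq_rpow
      (EuclideanSpace ℝ (Fin m)) (-1)).comp C.hasTemperateGrowth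
    refine (congrArg Function.HasTemperateGrowth ?_).mpr h
    funext ξ
    simp only [Function.comp, Real.rpow_neg_one]
    congr 1
    rw [EuclideanSpace.norm_sq_eq]
    have : ∀ k, C ξ k = Real.sqrt t * (2 * Real.pi) * inner ℝ (b k) ξ := by
      intro k; simp [C]
    simp only [this, Real.norm_eq_abs, sq_abs, hq, mul_pow, Real.sq_sqrt ht.le, ← Finset.mul_sum,
      real_inner_comm]
    ring
  refine ⟨SchwartzMap.fourierMultiplierCLM ℂ (fun ξ => (1 - t * q ξ)⁻¹) g, ?_⟩
  rw [LS_multiplier, ← hq]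
  rw [SchwartzMap.fourierMultiplierCLM_fourierMultiplierCLM_apply hqt hrt]
  have hqr : (q * fun ξ => (1 - t * q ξ)⁻¹).HasTemperateGrowth := hqt.mul hrt
  have hone : (fun ξ : Ed d => (1 - t * q ξ)⁻¹) =
      (fun _ => (1:ℝ)) + t • (q * fun ξ => (1 - t * q ξ)⁻¹) := by
    ext ξ
    have : 1 - t * q ξ ≠ 0 := by
      have : q ξ ≤ 0 := by
        rw [hq]
        have : 0 ≤ ∑ k, (inner ℝ ξ (b k)) ^ 2 := Finset.sum_nonneg fun _ _ => sq_nonneg _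
        have := mul_nonneg (sq_nonneg (2 * Real.pi)) this
        simp only; linarith
      nlinarith
    simp only [Pi.add_apply, Pi.smul_apply, Pi.mul_apply, smul_eq_mul]
    field_simp
    ring
  have hadd : SchwartzMap.fourierMultiplierCLM ℂ (fun ξ : Ed d => (1 - t * q ξ)⁻¹) g =
      g + t • SchwartzMap.fourierMultiplierCLM ℂ (q * fun ξ => (1 - t * q ξ)⁻¹) g := by
    have h1 : (fun _ : Ed d => (1:ℝ)).HasTemperateGrowth := .const 1
    have h2 : (t • (q * fun ξ => (1 - t * q ξ)⁻¹)).HasTemperateGrowth :=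
      (Function.HasTemperateGrowth.const t).smul hqr
    conv_lhs => rw [hone]
    rw [SchwartzMap.fourierMultiplierCLM_apply, SchwartzMap.smulLeftCLM_add h1 h2]
    rw [SchwartzMap.smulLeftCLM_smul hqr]
    simp [SchwartzMap.fourierMultiplierCLM_apply, FourierTransform.fourierInv_add, FourierTransform.fourierInv_smul]
  rw [hadd]; abel

lemma resolvent {d m : ℕ} (b : Fin m → Ed d) (t : ℝ) (ht : 0 < t) (g : 𝓢(Ed d, ℝ)) :
    ∃ u : 𝓢(Ed d, ℝ), ∀ x, u x - t * Lb b u x = g x := by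
  obtain ⟨v, hv⟩ := resolvent_C b t ht (g.postcompCLM Complex.ofRealCLM)
  refine ⟨v.postcompCLM Complex.reCLM, fun x => ?_⟩
  rw [← LS_apply]
  have hre : ∀ (k : Ed d) (h : 𝓢(Ed d, ℂ)), ∂_{k} (h.postcompCLM Complex.reCLM) =
      (∂_{k} h).postcompCLM Complex.reCLM := by
    intro k h
    ext y
    rw [SchwartzMap.lineDerivOp_apply_eq_fderiv, SchwartzMap.postcompCLM_apply,
      SchwartzMap.lineDerivOp_apply_eq_fderiv]
    have : (h.postcompCLM Complex.reCLM : Ed d → ℝ) = fun z => Complex.reCLM (h z) := rfl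
    rw [this]
    erw [(Complex.reCLM.hasFDerivAt.comp y (h.hasFDerivAt y)).fderiv]
    rfl
  have hL : LS b (v.postcompCLM Complex.reCLM) = (LS b v).postcompCLM Complex.reCLM := by
    unfold LS
    simp only [hre, map_sum]
  rw [hL]
  have := congrArg (fun h : 𝓢(Ed d, ℂ) => (h x).re) hv
  simpa using this



lemma second_deriv_nonpos {d : ℕ} (φ : Ed d → ℝ) (hφ : ContDiff ℝ 2 φ) (x v : Ed d)
    (hx : IsLocalMax φ x) : iteratedFDeriv ℝ 2 φ x ![v, v] ≤ 0 := by
  by_contra! hpos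
  have hline : ∀ s : ℝ, HasDerivAt (fun s : ℝ => x + s • v) v s := by
    intro s
    simpa using ((hasDerivAt_id s).smul_const v).const_add x
  have hd1 : deriv (fun s : ℝ => φ (x + s • v)) = fun s => fderiv ℝ φ (x + s • v) v := by
    funext s
    have := ((hφ.differentiable (by norm_num)) (x + s • v)).hasFDerivAt.comp_hasDerivAt s (hline s)
    exact this.deriv
  have hd2 : deriv (deriv (fun s : ℝ => φ (x + s • v))) 0 = iteratedFDeriv ℝ 2 φ x ![v, v] := by
    rw [hd1, iteratedFDeriv_two_apply]
    have hf : Differentiable ℝ (fderiv ℝ φ) :=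
      (hφ.fderiv_right (m := 1) (by norm_num)).differentiable (by norm_num)
    have h0 := (hf (x + (0:ℝ) • v)).hasFDerivAt.comp_hasDerivAt (0:ℝ) (hline 0)
    have h1 := h0.clm_apply (hasDerivAt_const (0:ℝ) v)
    rw [show deriv (fun s : ℝ => fderiv ℝ φ (x + s • v) v) 0 = _ from h1.deriv]
    simp
  have hmax : IsLocalMax (fun s : ℝ => φ (x + s • v)) 0 := by
    have hc : Tendsto (fun s : ℝ => x + s • v) (𝓝 0) (𝓝 x) := by
      have : Continuous (fun s : ℝ => x + s • v) := by fun_prop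
      simpa using this.tendsto 0
    have := hc.eventually hx
    simpa [IsLocalMax, IsMaxFilter] using this
  have hcont : Continuous (fun s : ℝ => φ (x + s • v)) := hφ.continuous.comp (by fun_prop)
  have hmin : IsLocalMin (fun s : ℝ => φ (x + s • v)) 0 :=
    isLocalMin_of_deriv_deriv_pos (by rw [hd2]; exact hpos) hmax.deriv_eq_zero hcont.continuousAt
  have hconst : (fun s : ℝ => φ (x + s • v)) =ᶠ[𝓝 0] fun _ => φ (x + (0:ℝ) • v) := by
    filter_upwards [hmax, hmin] with s h1 h2
    exact le_antisymm h1 h2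
  have := hconst.deriv.deriv_eq
  rw [hd2] at this
  simp at this
  linarith

lemma Lb_nonpos_of_localMax {d m : ℕ} (b : Fin m → Ed d) (φ : Ed d → ℝ) (hφ : ContDiff ℝ 2 φ)
    (x : Ed d) (hx : IsLocalMax φ x) : Lb b φ x ≤ 0 :=
  Finset.sum_nonpos fun k _ => second_deriv_nonpos φ hφ x (b k) hx

lemma maxP {d m : ℕ} (b : Fin m → Ed d) (t : ℝ) (ht : 0 < t) (u : 𝓢(Ed d, ℝ)) (C : ℝ) (hC : 0 ≤ C)
    (h : ∀ x, u x - t * LS b u x ≤ C) (x : Ed d) : u x ≤ C := by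
  by_contra! hx
  have hev : ∀ᶠ y in cocompact (Ed d), u y ≤ u x :=
    (u.tendsto_cocompact.eventually_lt_const (lt_of_le_of_lt hC hx)).mono fun _ h => h.le
  obtain ⟨z, hz⟩ := u.continuous.exists_forall_ge' x hev
  have h1 : Lb b u z ≤ 0 := Lb_nonpos_of_localMax b u (u.smooth 2) z (Eventually.of_forall hz)
  have h2 := h z
  rw [LS_apply] at h2
  have h3 := hz x
  nlinarith

lemma LS_sub {d m : ℕ} (b : Fin m → Ed d) (u v : 𝓢(Ed d, ℝ)) : LS b (u - v) = LS b u - LS b v := by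
  have h : ∀ (k : Ed d) (u v : 𝓢(Ed d, ℝ)), ∂_{k} (u - v) = ∂_{k} u - ∂_{k} v := fun k u v =>
    map_sub (LineDeriv.lineDerivOpCLM ℝ 𝓢(Ed d, ℝ) k) u v
  unfold LS
  simp only [h, Finset.sum_sub_distrib]

lemma LS_smul {d m : ℕ} (b : Fin m → Ed d) (t : ℝ) (u : 𝓢(Ed d, ℝ)) :
    LS b (t • u) = t • LS b u := by
  have h : ∀ (k : Ed d) (u : 𝓢(Ed d, ℝ)), ∂_{k} (t • u) = t • ∂_{k} u := fun k u =>
    map_smul (LineDeriv.lineDerivOpCLM ℝ 𝓢(Ed d, ℝ) k) t u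
  unfold LS
  simp only [h, Finset.smul_sum]

lemma schwartz_bdd {d : ℕ} (u : 𝓢(Ed d, ℝ)) : ∃ C, 0 ≤ C ∧ ∀ x, |u x| ≤ C := by
  obtain ⟨C, hC, h⟩ := u.decay 0 0
  exact ⟨C, hC.le, fun x => by simpa using h x⟩

lemma upper {d m : ℕ} (b : Fin m → Ed d) (φ : 𝓢(Ed d, ℝ)) : ∃ C, 0 ≤ C ∧
    ∀ t : ℝ, 0 < t → ∀ s : ℝ, 0 ≤ s → ∀ u : 𝓢(Ed d, ℝ),
      (∀ x, u x - t * LS b u x ≤ φ x + s) →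
      ∀ x, u x ≤ φ x + t * LS b φ x + C * t ^ 2 + s := by
  obtain ⟨C, hC, hb⟩ := schwartz_bdd (LS b (LS b φ))
  refine ⟨C, hC, fun t ht s hs u hu x => ?_⟩
  have := maxP b t ht (u - (φ - (-t) • LS b φ)) (C * t ^ 2 + s) (by positivity) (fun y => by
    rw [LS_sub, LS_sub, LS_smul]
    have h1 := hu y
    have h2 := (abs_le.1 (hb y)).2
    have h3 : t ^ 2 * LS b (LS b φ) y ≤ t ^ 2 * C := by gcongr
    simp only [_root_.sub_apply, _root_.smul_apply, smul_eq_mul]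
    nlinarith) x
  simp only [_root_.sub_apply, _root_.smul_apply, smul_eq_mul] at this
  linarith

lemma expansion {d m : ℕ} (b : Fin m → Ed d) (φ : 𝓢(Ed d, ℝ)) : ∃ C, 0 ≤ C ∧
    ∀ t : ℝ, 0 < t → ∀ v : 𝓢(Ed d, ℝ), (∀ x, v x - t * LS b v x = φ x) →
      ∀ x, |v x - (φ x + t * LS b φ x)| ≤ C * t ^ 2 := by
  obtain ⟨C, hC, h1⟩ := upper b φ
  obtain ⟨C', hC', h2⟩ := upper b ((-1:ℝ) • φ)
  refine ⟨C + C', by positivity, fun t ht v hv x => ?_⟩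
  have e1 := h1 t ht 0 le_rfl v (fun y => by rw [hv y]; simp) x
  have e2 := h2 t ht 0 le_rfl ((-1:ℝ) • v) (fun y => by
    rw [LS_smul]
    simp only [_root_.smul_apply, smul_eq_mul]
    linarith [hv y]) x
  rw [LS_smul] at e2
  simp only [_root_.smul_apply, smul_eq_mul] at e2
  have : 0 ≤ C * t ^ 2 := by positivity
  have : 0 ≤ C' * t ^ 2 := by positivity
  rw [abs_le]
  constructor <;> nlinarith

lemma comparison {d m : ℕ} (b : Fin m → Ed d) (K : Set (Ed d)) (hK : IsCompact K)
    (W : Ed d → ℝ) (hW : LowerSemicontinuousOn W K) (hW0 : ∀ x ∈ K, 0 ≤ W x)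
    (hv : ∀ φ : Ed d → ℝ, ContDiff ℝ 2 φ → ∀ x ∈ interior K,
      (∀ y ∈ K, W x - φ x ≤ W y - φ y) → Lb b φ x ≤ 0)
    (t e : ℝ) (ht : 0 < t) (u : 𝓢(Ed d, ℝ))
    (hu : ∀ x ∈ K, u x - t * LS b u x ≤ W x + e)
    (hb : ∀ x ∈ K, x ∉ interior K → u x ≤ e) : ∀ x ∈ K, u x ≤ W x + e := by
  intro x hx
  by_contra! hlt
  have hl : LowerSemicontinuousOn (fun y => W y + (- u y)) K :=
    hW.add (u.continuous.neg.lowerSemicontinuous.lowerSemicontinuousOn K)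
  obtain ⟨z, hz, hmin⟩ := hl.exists_isMinOn ⟨x, hx⟩ hK
  have hmin' : ∀ y ∈ K, W z - u z ≤ W y - u y := fun y hy => by
    have := hmin hy
    simp only [mem_ofPred_eq] at this
    linarith
  have h1 := hmin' x hx
  by_cases hzi : z ∈ interior K
  · have h2 := hv u (u.smooth 2) z hzi hmin'
    rw [← LS_apply] at h2
    have h3 := hu z hz
    nlinarith
  · have := hb z hz hzi
    have := hW0 z hz
    linarith



/-- Lipschitz regularization. -/
noncomputable def infc {d : ℕ} (W : Ed d → ℝ) (n : ℕ) (x : Ed d) : ℝ :=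
  ⨅ y, (W y + n * dist x y)

lemma infc_bdd {d : ℕ} (W : Ed d → ℝ) (h0 : ∀ x, 0 ≤ W x) (n : ℕ) (x : Ed d) :
    BddBelow (range fun y => W y + n * dist x y) :=
  ⟨0, by rintro _ ⟨y, rfl⟩; have := h0 y; simp only; positivity⟩

lemma infc_nonneg {d : ℕ} (W : Ed d → ℝ) (h0 : ∀ x, 0 ≤ W x) (n : ℕ) (x : Ed d) :
    0 ≤ infc W n x :=
  le_ciInf fun y => by have := h0 y; positivity

lemma infc_le {d : ℕ} (W : Ed d → ℝ) (h0 : ∀ x, 0 ≤ W x) (n : ℕ) (x : Ed d) :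
    infc W n x ≤ W x := by
  have := ciInf_le (infc_bdd W h0 n x) x
  simpa [infc] using this

lemma infc_cont {d : ℕ} (W : Ed d → ℝ) (h0 : ∀ x, 0 ≤ W x) (n : ℕ) :
    Continuous (infc W n) := by
  refine (LipschitzWith.of_le_add_mul (K := (n : ℝ≥0)) (fun x y => ?_)).continuous
  rw [← sub_le_iff_le_add]
  refine le_ciInf fun z => ?_
  have h1 : infc W n x ≤ W z + n * dist x z := ciInf_le (infc_bdd W h0 n x) z
  have h2 : (n:ℝ) * dist x z ≤ n * (dist x y + dist y z) := by
    gcongr; exact dist_triangle _ _ _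
  simp only [NNReal.coe_natCast]
  linarith

lemma infc_tendsto {d : ℕ} (W : Ed d → ℝ) (h0 : ∀ x, 0 ≤ W x) (hl : LowerSemicontinuous W)
    (x : Ed d) : Tendsto (fun n => infc W n x) atTop (𝓝 (W x)) := by
  rw [Metric.tendsto_atTop]
  intro ε hε
  have h1 := hl x (W x - ε / 2) (by linarith)
  obtain ⟨δ, hδ, hball⟩ := Metric.eventually_nhds_iff.1 h1
  obtain ⟨N, hN⟩ := exists_nat_gt (W x / δ)
  refine ⟨N, fun n hn => ?_⟩
  have h2 := infc_le W h0 n x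
  have h3 : W x - ε / 2 ≤ infc W n x := by
    refine le_ciInf fun y => ?_
    by_cases hy : dist y x < δ
    · have := hball hy
      have : (0:ℝ) ≤ n * dist x y := by positivity
      linarith
    · push Not at hy
      rw [dist_comm] at hy
      have h4 : (W x / δ) * δ ≤ n * dist x y := by
        have : (N:ℝ) ≤ n := by exact_mod_cast hn
        have h5 := h0 x
        gcongr
        linarith
      rw [div_mul_cancel₀ _ hδ.ne'] at h4
      linarith [h0 y]
  rw [Real.dist_eq, abs_lt]
  constructor <;> linarith

lemma approx {d : ℕ} (W : Ed d → ℝ) (h0 : ∀ x, 0 ≤ W x) (N : ℝ) (hN : ∀ x, W x ≤ N)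
    (hl : LowerSemicontinuous W) (hc : HasCompactSupport W) :
    ∃ g : ℕ → 𝓢(Ed d, ℝ), (∀ n x, g n x ≤ W x + 1 / ((n:ℝ) + 1)) ∧
      (∀ n x, |g n x| ≤ N + 1) ∧ ∀ x, Tendsto (fun n => g n x) atTop (𝓝 (W x)) := by
  have key : ∀ n : ℕ, ∃ g : 𝓢(Ed d, ℝ), ∀ x, |g x - infc W n x| < 1 / ((n:ℝ) + 1) := by
    intro n
    obtain ⟨g, hg, hd, hs⟩ := (infc_cont W h0 n).exists_contDiff_approx (⊤ : ℕ∞)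
      (ε := fun _ => 1 / ((n:ℝ) + 1)) continuous_const (fun _ => by positivity)
    have hs2 : Function.support (infc W n) ⊆ Function.support W := by
      intro x hx hx0
      exact hx (le_antisymm ((infc_le W h0 n x).trans hx0.le) (infc_nonneg W h0 n x))
    have hgc : HasCompactSupport g := hc.mono (hs.trans hs2)
    exact ⟨hgc.toSchwartzMap hg, fun x => by simpa [Real.dist_eq] using hd x⟩
  choose g hg using key
  refine ⟨g, fun n x => ?_, fun n x => ?_, fun x => ?_⟩
  · have := (abs_lt.1 (hg n x)).2
    linarith [infc_le W h0 n x]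
  · have h1 := abs_lt.1 (hg n x)
    have h2 := infc_le W h0 n x
    have h3 := infc_nonneg W h0 n x
    have h4 : 1 / ((n:ℝ) + 1) ≤ 1 := by
      rw [div_le_one (by positivity)]; linarith [(Nat.cast_nonneg n : (0:ℝ) ≤ n)]
    have h5 := hN x
    rw [abs_le]
    constructor <;> linarith
  · have h1 : Tendsto (fun n => g n x - infc W n x) atTop (𝓝 0) :=
      squeeze_zero_norm (fun n => (hg n x).le) tendsto_one_div_add_atTop_nhds_zero_nat
    simpa using h1.add (infc_tendsto W h0 hl x)



lemma LS_tsupport {d m : ℕ} (b : Fin m → Ed d) (f : 𝓢(Ed d, ℝ)) (x : Ed d) (hx : x ∉ tsupport f) :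
    LS b f x = 0 := by
  unfold LS
  rw [_root_.sum_apply]
  refine Finset.sum_eq_zero fun k _ => ?_
  have h : x ∉ tsupport ((∂_{b k} (∂_{b k} f) : 𝓢(Ed d, ℝ)) : Ed d → ℝ) := fun h =>
    hx (SchwartzMap.tsupport_lineDerivOp_subset _ _ (SchwartzMap.tsupport_lineDerivOp_subset _ _ h))
  exact image_eq_zero_of_notMem_tsupport h

lemma cutoff {d : ℕ} (K' K : Set (Ed d)) (hK' : IsCompact K')
    (h : K' ⊆ interior K) : ∃ χ : 𝓢(Ed d, ℝ), (∀ x, 0 ≤ χ x) ∧ (∀ x, χ x ≤ 1) ∧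
      (∀ x ∈ K', χ x = 1) ∧ tsupport χ ⊆ interior K := by
  obtain ⟨L, hL, h1, h2⟩ := exists_compact_between hK' isOpen_interior h
  obtain ⟨f, hf, hr, hs, ht⟩ := exists_contMDiff_support_eq_eq_one_iff (n := ⊤)
    (modelWithCornersSelf ℝ (Ed d)) (isOpen_interior (s := L)) hK'.isClosed h1
  have hf' : ContDiff ℝ ∞ f := hf.contDiff
  have hts : tsupport f ⊆ L := by
    rw [tsupport, hs]
    exact closure_minimal interior_subset hL.isClosed
  have hc : HasCompactSupport f := hL.of_isClosed_subset (isClosed_tsupport _) hts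
  refine ⟨hc.toSchwartzMap hf', fun x => ?_, fun x => ?_, fun x hx => ?_, ?_⟩
  · exact (hr ⟨x, rfl⟩).1
  · exact (hr ⟨x, rfl⟩).2
  · exact (ht x).1 hx
  · exact hts.trans h2

lemma lsc_trunc {d : ℕ} (V : Set (Ed d)) (hV : IsOpen V) (W : Ed d → ℝ)
    (hW : LowerSemicontinuousOn W V) (hW0 : ∀ x ∈ V, 0 ≤ W x) (N : ℝ) (hN : 0 ≤ N) :
    LowerSemicontinuous (V.indicator fun x => min (W x) N) := by
  intro x y hy
  by_cases hx : x ∈ V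
  · rw [indicator_of_mem hx] at hy
    have h1 := hW x hx y (lt_of_lt_of_le hy (min_le_left _ _))
    rw [hV.nhdsWithin_eq hx] at h1
    filter_upwards [h1, hV.mem_nhds hx] with z hz hzV
    rw [indicator_of_mem hzV]
    exact lt_min hz (lt_of_lt_of_le hy (min_le_right _ _))
  · rw [indicator_of_notMem hx] at hy
    filter_upwards with z
    refine lt_of_lt_of_le hy ?_
    by_cases hz : z ∈ V
    · rw [indicator_of_mem hz]; exact le_min (hW0 z hz) hN
    · rw [indicator_of_notMem hz]

lemma core_trunc {d m : ℕ} (b : Fin m → Ed d) (K' K : Set (Ed d)) (hK' : IsCompact K')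
    (hK : IsCompact K) (hKK : K' ⊆ interior K) (W0 : Ed d → ℝ) (hW : LowerSemicontinuousOn W0 K)
    (hW0 : ∀ x ∈ K, 0 ≤ W0 x)
    (hv : ∀ φ : Ed d → ℝ, ContDiff ℝ 2 φ → ∀ x ∈ interior K,
      (∀ y ∈ K, W0 x - φ x ≤ W0 y - φ y) → Lb b φ x ≤ 0)
    (N : ℝ) (hN : 0 ≤ N) (ψ : 𝓢(Ed d, ℝ)) (hψ : ∀ x, 0 ≤ ψ x)
    (hψs : tsupport ψ ⊆ interior K') :
    ∫ x, LS b ψ x * (interior K').indicator (fun x => min (W0 x) N) x ≤ 0 := by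
  set W := (interior K').indicator (fun x => min (W0 x) N) with hWdef
  have hsub : interior K' ⊆ K := interior_subset.trans (hKK.trans interior_subset)
  have hlsc : LowerSemicontinuous W := lsc_trunc _ isOpen_interior W0 (hW.mono hsub)
    (fun x hx => hW0 x (hsub hx)) N hN
  have hWnn : ∀ x, 0 ≤ W x := fun x => by
    by_cases hx : x ∈ interior K'
    · simp only [hWdef, indicator_of_mem hx]; exact le_min (hW0 x (hsub hx)) hN
    · simp only [hWdef, indicator_of_notMem hx]; exact le_rfl
  have hWN : ∀ x, W x ≤ N := fun x => by
    by_cases hx : x ∈ interior K'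
    · simp only [hWdef, indicator_of_mem hx]; exact min_le_right _ _
    · simp only [hWdef, indicator_of_notMem hx]; exact hN
  have hWW0 : ∀ x ∈ K, W x ≤ W0 x := fun x hxK => by
    by_cases hx : x ∈ interior K'
    · simp only [hWdef, indicator_of_mem hx]; exact min_le_left _ _
    · simp only [hWdef, indicator_of_notMem hx]; exact hW0 x hxK
  have hWc : HasCompactSupport W := by
    refine HasCompactSupport.intro hK' fun x hx => ?_
    exact indicator_of_notMem (fun h => hx (interior_subset h)) _
  have hWm : Measurable W := hlsc.measurable
  have hWi : Integrable W := by
    refine Measure.integrableOn_of_bounded (M := N) (s := tsupport W) ?_ ?_ ?_ |>.integrable_of_forall_notMem_eq_zero ?_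
    · exact hWc.isCompact.measure_lt_top.ne
    · exact hWm.aestronglyMeasurable
    · filter_upwards with x
      rw [Real.norm_eq_abs, abs_of_nonneg (hWnn x)]; exact hWN x
    · intro x hx; exact image_eq_zero_of_notMem_tsupport hx
  have hSW : ∀ g : 𝓢(Ed d, ℝ), Integrable fun x => g x * W x := fun g => by
    refine (g.integrable (μ := volume)).mul_bdd (c := N) hWm.aestronglyMeasurable ?_
    filter_upwards with x
    rw [Real.norm_eq_abs, abs_of_nonneg (hWnn x)]; exact hWN x
  have hSS : ∀ g h : 𝓢(Ed d, ℝ), Integrable fun x => g x * h x := fun g h => by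
    obtain ⟨C, hC, hh⟩ := schwartz_bdd h
    exact (g.integrable (μ := volume)).mul_bdd (c := C) h.continuous.aestronglyMeasurable
      (Eventually.of_forall fun x => by simpa using hh x)
  obtain ⟨χ, hχ0, hχ1, hχK, hχs⟩ := cutoff K' K hK' hKK
  obtain ⟨C, hC, hup⟩ := upper b (N • χ)
  obtain ⟨C', hC', hex⟩ := expansion b ψ
  obtain ⟨g, hg1, hg2, hg3⟩ := approx W hWnn N hWN hlsc hWc
  have key : ∀ t : ℝ, 0 < t → ∫ x, LS b ψ x * W x ≤ t * (C * (∫ x, ψ x) + C' * ∫ x, W x) := by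
    intro t ht
    obtain ⟨v, hv'⟩ := resolvent b t ht ψ
    have hvr : ∀ x, v x - t * LS b v x = ψ x := fun x => by rw [LS_apply]; exact hv' x
    have hvW : ∫ x, v x * W x ≤ (∫ x, ψ x * W x) + C * t ^ 2 * ∫ x, ψ x := by
      have hn : ∀ n : ℕ, ∫ x, v x * g n x ≤
          (∫ x, ψ x * W x) + (C * t ^ 2 + 1 / ((n:ℝ) + 1)) * ∫ x, ψ x := by
        intro n
        obtain ⟨u, hu'⟩ := resolvent b t ht (g n)
        have hur : ∀ x, u x - t * LS b u x = g n x := fun x => by rw [LS_apply]; exact hu' x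
        have hs : (0:ℝ) ≤ 1 / ((n:ℝ) + 1) := by positivity
        have hub := hup t ht _ hs u (fun x => by
          rw [hur]
          refine (hg1 n x).trans (add_le_add ?_ le_rfl)
          rw [_root_.smul_apply, smul_eq_mul]
          by_cases hx : x ∈ interior K'
          · rw [hχK x (interior_subset hx), mul_one]; exact hWN x
          · simp only [hWdef, indicator_of_notMem hx]; exact mul_nonneg hN (hχ0 x))
        have hub2 : ∀ x ∈ K, x ∉ interior K → u x ≤ C * t ^ 2 + 1 / ((n:ℝ) + 1) := by
          intro x _ hx
          have hx' : x ∉ tsupport χ := fun h => hx (hχs h)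
          have := hub x
          rw [LS_smul, _root_.smul_apply, _root_.smul_apply, LS_tsupport b χ x hx',
            image_eq_zero_of_notMem_tsupport hx'] at this
          simpa using this
        have hcmp := comparison b K hK W0 hW hW0 hv t (C * t ^ 2 + 1 / ((n:ℝ) + 1)) ht u
          (fun x hx => by
            rw [hur]
            have := hg1 n x; have := hWW0 x hx
            have : 0 ≤ C * t ^ 2 := by positivity
            linarith) hub2
        have hmax := maxP b t ht u (N + 1 / ((n:ℝ) + 1)) (by positivity) (fun x => by
            rw [hur]; have := hg1 n x; have := hWN x; linarith)
        have hpt : ∀ x, ψ x * u x ≤ ψ x * W x + (C * t ^ 2 + 1 / ((n:ℝ) + 1)) * ψ x := by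
          intro x
          by_cases hx : x ∈ tsupport ψ
          · have hx2 := hψs hx
            have h1 := hcmp x (hsub hx2)
            have h2 := hmax x
            have h3 : u x ≤ W x + (C * t ^ 2 + 1 / ((n:ℝ) + 1)) := by
              simp only [hWdef, indicator_of_mem hx2]
              have : 0 ≤ C * t ^ 2 := by positivity
              rcases le_total (W0 x) N with h | h
              · rw [min_eq_left h]; exact h1
              · rw [min_eq_right h]; linarith
            nlinarith [mul_le_mul_of_nonneg_left h3 (hψ x)]
          · rw [image_eq_zero_of_notMem_tsupport hx]; simp
        have hI : ∫ x, v x * g n x = ∫ x, ψ x * u x := by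
          have e1 : ∀ x, v x * g n x = v x * u x - t * (v x * LS b u x) := fun x => by
            rw [← hur]; ring
          have e2 : ∀ x, ψ x * u x = v x * u x - t * (LS b v x * u x) := fun x => by
            rw [← hvr]; ring
          simp_rw [e1, e2]
          rw [integral_sub (hSS v u) ((hSS v _).const_mul t),
            integral_sub (hSS v u) ((hSS _ u).const_mul t), integral_const_mul,
            integral_const_mul, LS_selfadj]
        rw [hI]
        calc ∫ x, ψ x * u x ≤ ∫ x, (ψ x * W x + (C * t ^ 2 + 1 / ((n:ℝ) + 1)) * ψ x) :=
              integral_mono (hSS ψ u) ((hSW ψ).add (ψ.integrable.const_mul _)) hpt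
          _ = _ := by
            rw [integral_add (hSW ψ) (ψ.integrable.const_mul _), integral_const_mul]
      have l1 : Tendsto (fun n => ∫ x, v x * g n x) atTop (𝓝 (∫ x, v x * W x)) := by
        refine tendsto_integral_of_dominated_convergence (fun x => (N + 1) * |v x|)
          (fun n => (hSS v (g n)).aestronglyMeasurable) (v.integrable.abs.const_mul _) ?_ ?_
        · intro n
          filter_upwards with x
          rw [norm_mul, Real.norm_eq_abs, Real.norm_eq_abs, mul_comm]
          exact mul_le_mul_of_nonneg_right (hg2 n x) (abs_nonneg _)
        · filter_upwards with x
          exact (hg3 x).const_mul _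
      have l2 : Tendsto (fun n : ℕ => (∫ x, ψ x * W x) + (C * t ^ 2 + 1 / ((n:ℝ) + 1)) * ∫ x, ψ x)
          atTop (𝓝 ((∫ x, ψ x * W x) + (C * t ^ 2 + 0) * ∫ x, ψ x)) :=
        ((tendsto_one_div_add_atTop_nhds_zero_nat.const_add _).mul_const _).const_add _
      rw [add_zero] at l2
      exact le_of_tendsto_of_tendsto' l1 l2 hn
    have hlow : ∫ x, (ψ x * W x + t * (LS b ψ x * W x) - C' * t ^ 2 * W x) ≤ ∫ x, v x * W x := by
      refine integral_mono (((hSW ψ).add ((hSW _).const_mul t)).sub (hWi.const_mul _)) (hSW v) ?_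
      intro x
      have h1 := (abs_le.1 (hex t ht v hvr x)).1
      have h2 := mul_le_mul_of_nonneg_right h1 (hWnn x)
      simp only
      nlinarith
    have hadd : Integrable (fun x => ψ x * W x + t * (LS b ψ x * W x)) :=
      (hSW ψ).add ((hSW _).const_mul t)
    rw [integral_sub hadd (hWi.const_mul _),
      integral_add (hSW ψ) ((hSW _).const_mul t), integral_const_mul, integral_const_mul] at hlow
    have h3 : t * ∫ x, LS b ψ x * W x ≤ t * (t * (C * (∫ x, ψ x) + C' * ∫ x, W x)) := by
      nlinarith
    exact le_of_mul_le_mul_left h3 ht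
  have hlim : Tendsto (fun t : ℝ => t * (C * (∫ x, ψ x) + C' * ∫ x, W x)) (𝓝[>] 0) (𝓝 0) := by
    have : Tendsto (fun t : ℝ => t * (C * (∫ x, ψ x) + C' * ∫ x, W x)) (𝓝 0)
      (𝓝 (0 * (C * (∫ x, ψ x) + C' * ∫ x, W x))) := tendsto_id.mul_const _
    rw [zero_mul] at this
    exact this.mono_left nhdsWithin_le_nhds
  exact ge_of_tendsto hlim (by filter_upwards [self_mem_nhdsWithin] with t ht using key t ht)



lemma nsq_second {d : ℕ} (x u v : Ed d) :
    iteratedFDeriv ℝ 2 (fun y : Ed d => ‖y‖ ^ 2) x ![u, v] = 2 * inner ℝ u v := by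
  rw [iteratedFDeriv_two_apply]
  have h1 : fderiv ℝ (fun y : Ed d => ‖y‖ ^ 2) = fun y => (2:ℝ) • innerSL ℝ y := by
    funext y
    rw [(hasStrictFDerivAt_norm_sq y).hasFDerivAt.fderiv]
    ext z; simp
  rw [h1]
  have h2 : HasFDerivAt (fun y : Ed d => (2:ℝ) • (innerSL ℝ y : Ed d →L[ℝ] ℝ)) ((2:ℝ) • innerSL ℝ) x :=
    ((innerSL ℝ : Ed d →L[ℝ] (Ed d →L[ℝ] ℝ)).hasFDerivAt).const_smul (2:ℝ)
  rw [h2.fderiv]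
  simp only [Matrix.cons_val_zero, Matrix.cons_val_one, _root_.smul_apply, smul_eq_mul]
  rfl

lemma Lb_nsq {d m : ℕ} (b : Fin m → Ed d) (x : Ed d) :
    Lb b (fun y : Ed d => ‖y‖ ^ 2) x = 2 * ∑ k, ‖b k‖ ^ 2 := by
  unfold Lb
  simp only [nsq_second, real_inner_self_eq_norm_sq, Finset.mul_sum]

lemma Lb_const {d m : ℕ} (b : Fin m → Ed d) (a : ℝ) (x : Ed d) :
    Lb b (fun _ : Ed d => a) x = 0 := by
  unfold Lb
  simp [iteratedFDeriv_const_of_ne]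

lemma Lb_add {d m : ℕ} (b : Fin m → Ed d) (φ p : Ed d → ℝ) (hφ : ContDiff ℝ 2 φ)
    (hp : ContDiff ℝ 2 p) (x : Ed d) :
    Lb b (fun y => φ y + p y) x = Lb b φ x + Lb b p x := by
  unfold Lb
  rw [← Finset.sum_add_distrib]
  refine Finset.sum_congr rfl fun k _ => ?_
  have := iteratedFDeriv_add_apply (i := 2) (x := x) hφ.contDiffAt hp.contDiffAt
  rw [show (fun y => φ y + p y) = φ + p from rfl, this]
  rfl

lemma Lb_smul {d m : ℕ} (b : Fin m → Ed d) (a : ℝ) (p : Ed d → ℝ)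
    (hp : ContDiff ℝ 2 p) (x : Ed d) :
    Lb b (fun y => a * p y) x = a * Lb b p x := by
  unfold Lb
  rw [Finset.mul_sum]
  refine Finset.sum_congr rfl fun k _ => ?_
  have := iteratedFDeriv_const_smul_apply (i := 2) (x := x) (a := a) hp.contDiffAt
  rw [show (fun y => a * p y) = a • p from rfl, this]
  rfl

lemma ibp {d m : ℕ} (b : Fin m → Ed d) (p : Ed d → ℝ) (hp : ContDiff ℝ ∞ p)
    (ψ : 𝓢(Ed d, ℝ)) (hψ : HasCompactSupport ψ) :
    ∫ x, LS b ψ x * p x = ∫ x, Lb b p x * ψ x := by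
  obtain ⟨K', hK', h1, -⟩ := exists_compact_between hψ.isCompact isOpen_univ (subset_univ _)
  obtain ⟨K, hK, h2, -⟩ := exists_compact_between hK' isOpen_univ (subset_univ _)
  obtain ⟨χ, -, -, hχ1, hχs⟩ := cutoff K' K hK' h2
  have hχc : HasCompactSupport χ := hK.of_isClosed_subset (isClosed_tsupport _)
    (hχs.trans interior_subset)
  have hPc : HasCompactSupport (fun x => χ x * p x) := hχc.mul_right
  have hPs : ContDiff ℝ ∞ (fun x => χ x * p x) := (χ.smooth ⊤).mul hp
  have := LS_selfadj b (hPc.toSchwartzMap hPs) ψ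
  have e1 : ∀ x, LS b ψ x * p x = (hPc.toSchwartzMap hPs) x * LS b ψ x := by
    intro x
    by_cases hx : x ∈ tsupport ψ
    · simp [HasCompactSupport.toSchwartzMap_toFun, hχ1 x (interior_subset (h1 hx)), mul_comm]
    · rw [LS_tsupport b ψ x hx]; simp
  have e2 : ∀ x, Lb b p x * ψ x = LS b (hPc.toSchwartzMap hPs) x * ψ x := by
    intro x
    by_cases hx : x ∈ tsupport ψ
    · rw [LS_apply]
      congr 1
      unfold Lb
      have : p =ᶠ[𝓝 x] (hPc.toSchwartzMap hPs) := by
        filter_upwards [isOpen_interior.mem_nhds (h1 hx)] with y hy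
        simp [HasCompactSupport.toSchwartzMap_toFun, hχ1 y (interior_subset hy)]
      rw [(this.iteratedFDeriv ℝ 2).eq_of_nhds]
    · rw [image_eq_zero_of_notMem_tsupport hx]; simp
  simp_rw [e1, e2]
  exact this

lemma LS_hasCompactSupport {d m : ℕ} (b : Fin m → Ed d) (ψ : 𝓢(Ed d, ℝ))
    (hψ : HasCompactSupport ψ) : HasCompactSupport (LS b ψ) :=
  HasCompactSupport.intro hψ.isCompact fun x hx => LS_tsupport b ψ x hx

lemma integrable_mul_loc {d m : ℕ} (b : Fin m → Ed d) (ψ : 𝓢(Ed d, ℝ))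
    (hψ : HasCompactSupport ψ) (w : Ed d → ℝ) (hloc : LocallyIntegrable w volume) :
    Integrable fun x => LS b ψ x * w x := by
  have := hloc.integrable_smul_left_of_hasCompactSupport (LS b ψ).continuous
    (LS_hasCompactSupport b ψ hψ)
  simpa using this

lemma core {d m : ℕ} (b : Fin m → Ed d) (U : Set (Ed d)) (hU : IsOpen U) (w : Ed d → ℝ)
    (hloc : LocallyIntegrable w volume) (hlsc : LowerSemicontinuousOn w U)
    (hv : ∀ φ : Ed d → ℝ, ContDiff ℝ 2 φ → ∀ x ∈ U,
      IsLocalMinOn (fun y => w y - φ y) U x → Lb b φ x ≤ 0)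
    (ψ : 𝓢(Ed d, ℝ)) (hψ : ∀ x, 0 ≤ ψ x) (hc : HasCompactSupport ψ) (hs : tsupport ψ ⊆ U) :
    ∫ x, LS b ψ x * w x ≤ 0 := by
  obtain ⟨K', hK', h1, h2⟩ := exists_compact_between hc.isCompact hU hs
  obtain ⟨K, hK, h3, h4⟩ := exists_compact_between hK' hU h2
  obtain ⟨A, hA⟩ : ∃ A : ℝ, ∀ x ∈ K, 0 ≤ w x + A := by
    rcases K.eq_empty_or_nonempty with h | h
    · exact ⟨0, by simp [h]⟩
    · obtain ⟨a, ha, hm⟩ := LowerSemicontinuousOn.exists_isMinOn h hK (hlsc.mono h4)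
      exact ⟨-w a, fun x hx => by have := hm hx; simp only [mem_ofPred_eq] at this; linarith⟩
  have hlA : LocallyIntegrable (fun x => w x + A) volume :=
    hloc.add (locallyIntegrable_const A)
  have hlscA : LowerSemicontinuousOn (fun x => w x + A) K := by
    intro x hx y hy
    have := hlsc.mono h4 x hx (y - A) (by linarith)
    filter_upwards [this] with z hz
    linarith
  have hT : ∀ n : ℕ, ∫ x, LS b ψ x * (interior K').indicator (fun x => min (w x + A) n) x ≤ 0 := by
    intro n
    refine core_trunc b K' K hK' hK h3 (fun x => w x + A) hlscA hA ?_ n (by positivity) ψ hψ h1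
    intro φ hφ x hx hmin
    refine hv φ hφ x (h4 (interior_subset hx)) ?_
    filter_upwards [mem_nhdsWithin_of_mem_nhds (isOpen_interior.mem_nhds hx)] with y hy
    have := hmin y (interior_subset hy)
    linarith
  have e0 : ∀ (n : ℕ) x, LS b ψ x * (interior K').indicator (fun x => min (w x + A) n) x =
      LS b ψ x * min (w x + A) n := by
    intro n x
    by_cases hx : x ∈ tsupport ψ
    · rw [indicator_of_mem (h1 hx)]
    · rw [LS_tsupport b ψ x hx]; simp
  have hlim : Tendsto (fun n : ℕ => ∫ x, LS b ψ x * min (w x + A) n) atTop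
      (𝓝 (∫ x, LS b ψ x * (w x + A))) := by
    refine tendsto_integral_of_dominated_convergence (fun x => |LS b ψ x * (w x + A)|)
      (fun n => ?_) (integrable_mul_loc b ψ hc _ hlA).abs (fun n => ?_) ?_
    · exact (LS b ψ).continuous.aestronglyMeasurable.mul
        (hlA.aestronglyMeasurable.inf aestronglyMeasurable_const)
    · filter_upwards with x
      rw [Real.norm_eq_abs, abs_mul, abs_mul]
      by_cases hx : x ∈ tsupport ψ
      · refine mul_le_mul_of_nonneg_left ?_ (abs_nonneg _)
        have h0 : 0 ≤ w x + A := hA x (interior_subset (h3 (interior_subset (h1 hx))))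
        rw [abs_of_nonneg h0, abs_of_nonneg (le_min h0 (by positivity))]
        exact min_le_left _ _
      · rw [LS_tsupport b ψ x hx]; simp
    · filter_upwards with x
      refine Tendsto.const_mul _ ?_
      obtain ⟨n0, hn0⟩ := exists_nat_ge (w x + A)
      refine tendsto_const_nhds.congr' ?_
      filter_upwards [eventually_ge_atTop n0] with n hn
      rw [min_eq_left]
      exact hn0.trans (by exact_mod_cast hn)
  have h5 : ∫ x, LS b ψ x * (w x + A) ≤ 0 := by
    refine le_of_tendsto' hlim fun n => ?_
    have := hT n
    simp_rw [e0] at this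
    exact this
  have h6 : ∫ x, LS b ψ x * A = 0 := by
    rw [ibp b (fun _ => A) contDiff_const ψ hc]
    simp [Lb_const]
  simp_rw [mul_add] at h5
  rw [integral_add (integrable_mul_loc b ψ hc w hloc)
    (integrable_mul_loc b ψ hc _ (locallyIntegrable_const A)), h6, add_zero] at h5
  exact h5

lemma core2 {d m : ℕ} (b : Fin m → Ed d) (hb : 0 < ∑ k, ‖b k‖ ^ 2) (c : ℝ)
    (U : Set (Ed d)) (hU : IsOpen U) (w : Ed d → ℝ)
    (hloc : LocallyIntegrable w volume) (hlsc : LowerSemicontinuousOn w U)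
    (hv : ∀ φ : Ed d → ℝ, ContDiff ℝ 2 φ → ∀ x ∈ U,
      IsLocalMinOn (fun y => w y - φ y) U x → Lb b φ x ≤ 2 * c)
    (ψ : 𝓢(Ed d, ℝ)) (hψ : ∀ x, 0 ≤ ψ x) (hc : HasCompactSupport ψ) (hs : tsupport ψ ⊆ U) :
    ∫ x, LS b ψ x * w x ≤ 2 * c * ∫ x, ψ x := by
  set a := c / ∑ k, ‖b k‖ ^ 2 with ha
  have hp : ContDiff ℝ ∞ (fun y : Ed d => a * ‖y‖ ^ 2) := contDiff_const.mul (contDiff_norm_sq ℝ)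
  have hpL : ∀ x, Lb b (fun y : Ed d => a * ‖y‖ ^ 2) x = 2 * c := fun x => by
    rw [Lb_smul b a _ (contDiff_norm_sq ℝ), Lb_nsq, ha]
    field_simp
  have hlp : LocallyIntegrable (fun y : Ed d => a * ‖y‖ ^ 2) volume :=
    hp.continuous.locallyIntegrable
  have h1 := core b U hU (fun y => w y - a * ‖y‖ ^ 2) (hloc.sub hlp) (by
    have : LowerSemicontinuousOn (fun y : Ed d => -(a * ‖y‖ ^ 2)) U :=
      (hp.continuous.neg.lowerSemicontinuous).lowerSemicontinuousOn _
    simpa [sub_eq_add_neg] using hlsc.add this) (by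
    intro φ hφ x hx hmin
    have h2 := hv (fun y => φ y + a * ‖y‖ ^ 2) (hφ.add (hp.of_le (by norm_cast))) x hx (by
      filter_upwards [hmin] with y hy
      linarith)
    rw [Lb_add b φ _ hφ (hp.of_le (by norm_cast)), hpL] at h2
    linarith) ψ hψ hc hs
  simp_rw [mul_sub] at h1
  rw [integral_sub (integrable_mul_loc b ψ hc w hloc)
    (integrable_mul_loc b ψ hc _ hlp), ibp b _ hp ψ hc] at h1
  simp_rw [hpL] at h1
  rw [integral_const_mul] at h1
  linarith



lemma conv_contDiff {d : ℕ} (w : Ed d → ℝ) (hloc : LocallyIntegrable w volume)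
    (ζ : 𝓢(Ed d, ℝ)) (hζ : HasCompactSupport ζ) :
    ContDiff ℝ ∞ (fun z => ∫ y, w y * ζ (z - y)) :=
  hζ.contDiff_convolution_right (ContinuousLinearMap.mul ℝ ℝ) hloc (ζ.smooth ⊤)

lemma conv_fderiv {d : ℕ} (w : Ed d → ℝ) (hloc : LocallyIntegrable w volume)
    (ζ : 𝓢(Ed d, ℝ)) (hζ : HasCompactSupport ζ) (x v : Ed d) :
    fderiv ℝ (fun z => ∫ y, w y * ζ (z - y)) x v =
      ∫ y, w y * (∂_{v} ζ : 𝓢(Ed d, ℝ)) (x - y) := by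
  have h := hζ.hasFDerivAt_convolution_right (ContinuousLinearMap.mul ℝ ℝ) hloc (ζ.smooth 1) x
  have h' : fderiv ℝ (fun z => ∫ y, w y * ζ (z - y)) x = _ := h.fderiv
  rw [h', convolution_precompR_apply (ContinuousLinearMap.mul ℝ ℝ) hloc (hζ.fderiv ℝ)
    ((ζ.smooth 1).continuous_fderiv (by simp))]
  rfl

lemma lineDeriv_cs {d : ℕ} (ζ : 𝓢(Ed d, ℝ)) (hζ : HasCompactSupport ζ) (v : Ed d) :
    HasCompactSupport (∂_{v} ζ : 𝓢(Ed d, ℝ)) :=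
  hζ.isCompact.of_isClosed_subset (isClosed_tsupport _)
    (SchwartzMap.tsupport_lineDerivOp_subset _ _)

lemma conv_Lb {d m : ℕ} (b : Fin m → Ed d) (w : Ed d → ℝ) (hloc : LocallyIntegrable w volume)
    (ζ : 𝓢(Ed d, ℝ)) (hζ : HasCompactSupport ζ) (x : Ed d) :
    Lb b (fun z => ∫ y, w y * ζ (z - y)) x = ∫ y, w y * LS b ζ (x - y) := by
  have hinteg : ∀ ξ : 𝓢(Ed d, ℝ), HasCompactSupport ξ → Integrable (fun y => w y * ξ (x - y)) := by
    intro ξ hξ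
    exact hξ.convolutionExists_right (ContinuousLinearMap.mul ℝ ℝ) hloc ξ.continuous x
  have h1 : ∀ y, w y * LS b ζ (x - y) =
      ∑ k, w y * (∂_{b k} (∂_{b k} ζ) : 𝓢(Ed d, ℝ)) (x - y) := by
    intro y
    unfold LS
    rw [_root_.sum_apply, Finset.mul_sum]
  simp_rw [h1]
  rw [integral_finsetSum _ fun k _ => hinteg _ (lineDeriv_cs _ (lineDeriv_cs _ hζ _) _)]
  unfold Lb
  refine Finset.sum_congr rfl fun k _ => ?_
  rw [iteratedFDeriv_two_apply]
  simp only [Matrix.cons_val_zero, Matrix.cons_val_one]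
  set G := (fun z => ∫ y, w y * ζ (z - y)) with hG
  have hGs : ContDiff ℝ ∞ G := conv_contDiff w hloc ζ hζ
  have hd : DifferentiableAt ℝ (fderiv ℝ G) x :=
    ((hGs.fderiv_right (m := 1) (by norm_cast)).differentiable (by simp)) x
  have h2 : fderiv ℝ (fun z => fderiv ℝ G z (b k)) x (b k) = fderiv ℝ (fderiv ℝ G) x (b k) (b k) := by
    rw [fderiv_clm_apply hd (differentiableAt_const _)]
    simp
  rw [← h2]
  have h3 : (fun z => fderiv ℝ G z (b k)) = fun z => ∫ y, w y * (∂_{b k} ζ : 𝓢(Ed d, ℝ)) (z - y) := by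
    funext z
    exact conv_fderiv w hloc ζ hζ z (b k)
  rw [h3]
  exact conv_fderiv w hloc _ (lineDeriv_cs _ hζ _) x (b k)

lemma Lb_reflect {d m : ℕ} (b : Fin m → Ed d) (ζ : Ed d → ℝ) (hζ : ContDiff ℝ ∞ ζ) (x y : Ed d) :
    Lb b (fun y => ζ (x - y)) y = Lb b ζ (x - y) := by
  unfold Lb
  refine Finset.sum_congr rfl fun k _ => ?_
  have e : (fun y => ζ (x - y)) = fun y => (fun z => ζ ((-1:ℝ) • z)) (y - x) := by
    funext y; simp
  rw [e, iteratedFDeriv_comp_sub (f := fun z => ζ ((-1:ℝ) • z)) 2 x y,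
    iteratedFDeriv_comp_const_smul (i := 2) (-1:ℝ) (hζ.of_le (by norm_cast))]
  simp

lemma moll {d m : ℕ} (b : Fin m → Ed d) (hb : 0 < ∑ k, ‖b k‖ ^ 2) (c : ℝ)
    (U : Set (Ed d)) (hU : IsOpen U) (w : Ed d → ℝ)
    (hloc : LocallyIntegrable w volume) (hlsc : LowerSemicontinuousOn w U)
    (hv : ∀ φ : Ed d → ℝ, ContDiff ℝ 2 φ → ∀ x ∈ U,
      IsLocalMinOn (fun y => w y - φ y) U x → Lb b φ x ≤ 2 * c)
    (ζ : Ed d → ℝ) (hζs : ContDiff ℝ ∞ ζ) (hζ0 : ∀ x, 0 ≤ ζ x) (ε : ℝ)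
    (hζ : ∀ z, ε < ‖z‖ → ζ z = 0) (hζ1 : ∫ z, ζ z = 1) (x : Ed d)
    (hx : Metric.closedBall x ε ⊆ U) :
    Lb b (fun z => ∫ y, w y * ζ (z - y)) x ≤ 2 * c := by
  have hζc : HasCompactSupport ζ := by
    refine HasCompactSupport.intro (isCompact_closedBall (0 : Ed d) ε) fun z hz => hζ z ?_
    simpa using hz
  have hts : tsupport (fun y => ζ (x - y)) ⊆ Metric.closedBall x ε := by
    refine closure_minimal (fun y hy => ?_) Metric.isClosed_closedBall
    by_contra h
    refine hy (hζ _ ?_)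
    rw [Metric.mem_closedBall, not_le, dist_comm, dist_eq_norm] at h
    exact h
  have hψc : HasCompactSupport (fun y => ζ (x - y)) :=
    (isCompact_closedBall x ε).of_isClosed_subset (isClosed_tsupport _) hts
  have hψs : ContDiff ℝ ∞ (fun y => ζ (x - y)) := hζs.comp (contDiff_const.sub contDiff_id)
  have h1 := core2 b hb c U hU w hloc hlsc hv (hψc.toSchwartzMap hψs) (fun y => hζ0 _) hψc
    (hts.trans hx)
  have h2 := conv_Lb b w hloc (hζc.toSchwartzMap hζs) hζc x
  have h3 : ∫ y, (hψc.toSchwartzMap hψs) y = 1 := by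
    have : ∫ y, (hψc.toSchwartzMap hψs) y = ∫ y, ζ (x - y) := rfl
    rw [this, integral_sub_left_eq_self ζ volume x, hζ1]
  have h4 : ∀ y, LS b (hψc.toSchwartzMap hψs) y * w y = w y * LS b (hζc.toSchwartzMap hζs) (x - y) := by
    intro y
    rw [LS_apply, LS_apply, mul_comm]
    congr 1
    exact Lb_reflect b ζ hζs x y
  rw [h3, mul_one] at h1
  simp_rw [h4] at h1
  rw [← h2] at h1
  exact h1

lemma frob_half {d : ℕ} (A M : Matd d) : frob ((1/2 : ℝ) • A) M = (1/2) * frob A M := by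
  unfold frob
  simp only [Matrix.smul_apply, smul_eq_mul, Finset.mul_sum, mul_assoc]

lemma sum_pos {d m : ℕ} (hd : 0 < d) (M : Matd d) (hM : M.PosDef) (b : Fin m → Ed d)
    (hb : ∀ φ : Ed d → ℝ, ∀ x, frob (hess φ x) M = Lb b φ x) : 0 < ∑ k, ‖b k‖ ^ 2 := by
  have : Nonempty (Fin d) := ⟨⟨0, hd⟩⟩
  have h := hb (fun y => ‖y‖ ^ 2) 0
  rw [Lb_nsq] at h
  have h2 : frob (hess (fun y : Ed d => ‖y‖ ^ 2) 0) M = 2 * M.trace := by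
    unfold frob hess
    simp only [nsq_second]
    simp [Matrix.trace, Finset.mul_sum, EuclideanSpace.inner_single_left]
  have := hM.trace_pos
  linarith

theorem main {d : ℕ} (hd : 0 < d) (f : Matd d → ℝ≥0∞)
    (U : Set (Ed d)) (hUopen : IsOpen U) (c : ℝ)
    (w : Ed d → ℝ) (hloc : LocallyIntegrable w volume)
    (hlsc : LowerSemicontinuousOn w U)
    (hsuper : IsViscSupersol f c w U)
    (η : Ed d → ℝ) (hηsmooth : ContDiff ℝ (⊤ : ℕ∞) η) (hηsupp : tsupport η = Metric.closedBall 0 1)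
    (hηpos : ∀ x, 0 ≤ η x) (hηint : ∫ x, η x = 1) (ε : ℝ) (hε : 0 < ε)
    (x : Ed d) (hx : ENNReal.ofReal ε < Metric.infEDist x Uᶜ) :
        Tcal f ((1/2 : ℝ) •
            hess (fun z => ∫ y, w y * (ε⁻¹ ^ d * η (ε⁻¹ • (z - y)))) x) ≤
          ((c : ℝ) : EReal) := by
  unfold Tcal
  refine sSup_le ?_
  rintro _ ⟨M, hM, hfM, rfl⟩
  obtain ⟨m, b, hb⟩ := posSemidef_decomp M hM.posSemidef
  rw [frob_half, hb]
  have hball : Metric.closedBall x ε ⊆ U := by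
    intro y hy
    by_contra h
    have h1 : Metric.infEDist x Uᶜ ≤ edist x y := Metric.infEDist_le_edist_of_mem h
    have h2 : edist x y ≤ ENNReal.ofReal ε := by
      rw [edist_dist, dist_comm]; exact ENNReal.ofReal_le_ofReal hy
    exact absurd hx (not_lt.2 (h1.trans h2))
  have := moll b (sum_pos hd M hM b hb) c U hUopen w hloc hlsc (by
    intro φ hφ z hz hmin
    have h1 := hsuper φ hφ.contDiffOn z hz hmin
    have h0 : ((frob ((1/2 : ℝ) • hess φ z) M : ℝ) : EReal) ≤ Tcal f ((1/2 : ℝ) • hess φ z) :=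
      le_sSup ⟨M, hM, hfM, rfl⟩
    have h2 := h0.trans h1
    rw [frob_half, hb, EReal.coe_le_coe_iff] at h2
    linarith) (fun z => ε⁻¹ ^ d * η (ε⁻¹ • z))
    (contDiff_const.mul (hηsmooth.comp (contDiff_const_smul _)))
    (fun z => mul_nonneg (by positivity) (hηpos _)) ε (by
      intro z hz
      have : η (ε⁻¹ • z) = 0 := by
        refine image_eq_zero_of_notMem_tsupport ?_
        rw [hηsupp, mem_closedBall_zero_iff, norm_smul, Real.norm_eq_abs,
          abs_of_pos (inv_pos.2 hε), not_le, inv_mul_eq_div, one_lt_div hε]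
        exact hz
      simp [this]) (by
      rw [integral_const_mul, Measure.integral_comp_smul, hηint, finrank_euclideanSpace_fin]
      have : 0 < ε⁻¹ ^ d := by positivity
      rw [abs_of_pos (inv_pos.2 this), smul_eq_mul, mul_one, mul_inv_cancel₀ this.ne']) x hball
  rw [EReal.coe_le_coe_iff]
  linarith


end Stmt17

/-- Corollary 4.14. If `w ∈ L¹_loc(ℝ^d)` is lower semicontinuous on the
open set `U` and is a viscosity supersolution of `c − 𝒯(½∇²w) = 0` in `U`, then for every
sufficiently small `ε > 0` its mollification `w_ε = w * η_ε` satisfies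
`c − 𝒯(½∇²w_ε) ≥ 0` pointwise in `U_ε = {x ∈ U : dist(x, ∂U) > ε}`. -/
theorem stmt17 {d : ℕ} (hd : 0 < d) (f : Matd d → ℝ≥0∞) (hA1 : CostA1 f) (hA2 : CostA2 f)
    (hA3 : (∀ M : Matd d, f M ≠ ⊤ ↔ M.PosSemidef) ∧
      ∃ k : ℝ, 0 < k ∧ ∀ A : Matd d, A.PosSemidef → f A ≤ ENNReal.ofReal (k * A.trace))
    (U : Set (Ed d)) (hUopen : IsOpen U) (c : ℝ)
    (w : Ed d → ℝ) (hloc : LocallyIntegrable w volume)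
    (hlsc : LowerSemicontinuousOn w U)
    (hsuper : IsViscSupersol f c w U)
    (η : Ed d → ℝ) (hηsmooth : ContDiff ℝ (⊤ : ℕ∞) η) (hηsupp : tsupport η = Metric.closedBall 0 1)
    (hηpos : ∀ x, 0 ≤ η x) (hηeven : ∀ x, η (-x) = η x) (hηint : ∫ x, η x = 1) :
    ∃ ε₀ : ℝ, 0 < ε₀ ∧ ∀ ε : ℝ, 0 < ε → ε < ε₀ →
      ∀ x ∈ U, ENNReal.ofReal ε < EMetric.infEdist x Uᶜ →
        Tcal f ((1/2 : ℝ) •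
            hess (fun z => ∫ y, w y * (ε⁻¹ ^ d * η (ε⁻¹ • (z - y)))) x) ≤
          ((c : ℝ) : EReal) := by
  exact ⟨1, one_pos, fun ε hε _ x _ hx =>
    Stmt17.main hd f U hUopen c w hloc hlsc hsuper η hηsmooth hηsupp hηpos hηint ε hε x hx⟩
end
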